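/- arXiv:2004.00174 — 5 statements merged into one kernel-verified Lean document; each statement's English description precedes it below -/
import Mathlib

section
/- The following are equivalent: (1) Turing equivalence ≡_T on 2^ω is hyper-recursively-finite; (2) every countable Borel equivalence relation on a standard Borel space is hyper-Borel-finite. -/
open scoped Classical

namespace SlamanSteel

/-- Partial recursive functions relative to an oracle `O : ℕ → ℕ`
(Mathlib's `Nat.Partrec` with an extra oracle clause). -/
inductive RecursiveIn (O : ℕ → ℕ) : (ℕ →. ℕ) → Prop
  | zero : RecursiveIn O (pure 0)
  | succ : RecursiveIn O fun n : ℕ => Part.some (Nat.succ n)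
  | left : RecursiveIn O fun n : ℕ => Part.some (Nat.unpair n).1
  | right : RecursiveIn O fun n : ℕ => Part.some (Nat.unpair n).2
  | oracle : RecursiveIn O fun n : ℕ => Part.some (O n)
  | pair {f g : ℕ →. ℕ} : RecursiveIn O f → RecursiveIn O g →
      RecursiveIn O fun n => Nat.pair <$> f n <*> g n
  | comp {f g : ℕ →. ℕ} : RecursiveIn O f → RecursiveIn O g →
      RecursiveIn O fun n => g n >>= f
  | prec {f g : ℕ →. ℕ} : RecursiveIn O f → RecursiveIn O g →
      RecursiveIn O (Nat.unpaired fun a n =>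
        n.rec (f a) fun y IH => do { let i ← IH; g (Nat.pair a (Nat.pair y i)) })
  | rfind {f : ℕ →. ℕ} : RecursiveIn O f →
      RecursiveIn O fun a => Nat.rfind fun n => (fun m => m = 0) <$> f (Nat.pair a n)

/-- The oracle (as a function `ℕ → ℕ`) associated to a real `x ∈ 2^ω`. -/
def oracleOf (x : ℕ → Bool) : ℕ → ℕ := fun n => cond (x n) 1 0

/-- `z ≤_T x` : `z` is computable relative to the oracle `x`. -/
def TuringLE (z x : ℕ → Bool) : Prop :=
  RecursiveIn (oracleOf x) fun n => Part.some (oracleOf z n)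

/-- Turing equivalence on `2^ω`. -/
def TuringEquiv (x y : ℕ → Bool) : Prop := TuringLE x y ∧ TuringLE y x

/-- The `j`th column of `y ∈ 2^ω`. -/
def column (y : ℕ → Bool) (j : ℕ) : ℕ → Bool := fun m => y (Nat.pair j m)

/-- `x ≤_m y` : many-one reducibility on `2^ω`. -/
def MLE (x y : ℕ → Bool) : Prop :=
  ∃ ρ : ℕ → ℕ, Computable ρ ∧ ∀ n, x n = y (ρ n)

/-- `x ≡_m y` : many-one equivalence on `2^ω`. -/
def MEquiv (x y : ℕ → Bool) : Prop := MLE x y ∧ MLE y x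

/-- `x ≤₁ y` : one-one reducibility on `2^ω`. -/
def OneLE (x y : ℕ → Bool) : Prop :=
  ∃ ρ : ℕ → ℕ, Computable ρ ∧ Function.Injective ρ ∧ ∀ n, x n = y (ρ n)

/-- `x ≡₁ y` : one-one equivalence on `2^ω`. -/
def OneEquiv (x y : ℕ → Bool) : Prop := OneLE x y ∧ OneLE y x

/-- The complement `x̄` of a real, flipping every bit. -/
def flipBits (x : ℕ → Bool) : ℕ → Bool := fun n => !(x n)

/-- The computable join `⊕_i z_i` of a sequence of reals: `(⊕_i z_i)(⟨i,m⟩) = z_i(m)`. -/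
def joinSeq (z : ℕ → ℕ → Bool) : ℕ → Bool :=
  fun k => z (Nat.unpair k).1 (Nat.unpair k).2

/-- The computable join of finitely many reals. -/
def joinFin {n : ℕ} (z : Fin n → ℕ → Bool) : ℕ → Bool := fun k =>
  if h : (Nat.unpair k).1 < n then z ⟨(Nat.unpair k).1, h⟩ (Nat.unpair k).2 else false

/-- The initial segment of `x` of length `k`, as a binary string. -/
def initSeg (x : ℕ → Bool) (k : ℕ) : List Bool := (List.range k).map x

/-- `W` is a set of strings which is computably enumerable relative to the oracle `x`. -/
def CEIn (x : ℕ → Bool) (W : Set (List Bool)) : Prop :=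
  ∃ f : ℕ →. ℕ, RecursiveIn (oracleOf x) f ∧
    ∀ σ : List Bool, σ ∈ W ↔ (f (Encodable.encode σ)).Dom

/-- `g` is `x`-generic (1-generic relative to `x`). -/
def GenericIn (x g : ℕ → Bool) : Prop :=
  ∀ W : Set (List Bool), CEIn x W →
    ∃ k, initSeg g k ∈ W ∨ ∀ τ : List Bool, initSeg g k <+: τ → τ ∉ W

/-- `g` is 1-generic. -/
def OneGeneric (g : ℕ → Bool) : Prop := GenericIn (fun _ => false) g

/-- Reals `z 0, …, z (n-1)` are mutually 1-generic if their join is 1-generic. -/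
def MutuallyOneGeneric {n : ℕ} (z : Fin n → ℕ → Bool) : Prop := OneGeneric (joinFin z)

/-- `E` is hyper-`(f_i)`-finite: `E` is an increasing union of Borel subequivalence
relations none of which has a class containing an infinite set `{f i x j : j ∈ ω}`. -/
def HyperFinWrt {X : Type*} [MeasurableSpace X] (E : X → X → Prop)
    (f : ℕ → X → ℕ → X) : Prop :=
  ∃ F : ℕ → X → X → Prop,
    (∀ n, Equivalence (F n)) ∧
    (∀ n, MeasurableSet {p : X × X | F n p.1 p.2}) ∧
    (∀ n a b, F n a b → F (n + 1) a b) ∧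
    (∀ a b, E a b ↔ ∃ n, F n a b) ∧
    (∀ n x i, (Set.range (f i x)).Infinite → ¬ Set.range (f i x) ⊆ {y | F n x y})

/-- `E` is hyper-Borel-finite: hyper-`(f_i)`-finite for every countable sequence of
Borel functions `f_i : X → X^ω`. -/
def HyperBorelFinite {X : Type*} [MeasurableSpace X] (E : X → X → Prop) : Prop :=
  ∀ f : ℕ → X → ℕ → X, (∀ i, Measurable (f i)) → HyperFinWrt E f

/-- Turing equivalence is hyper-recursively-finite: it is an increasing union of Borel
equivalence relations `F n` such that no `F n`-class of `x` contains, as an infinite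
subset, the set of columns of some `y ≤_T x`. -/
def HyperRecFin : Prop :=
  ∃ F : ℕ → (ℕ → Bool) → (ℕ → Bool) → Prop,
    (∀ n, Equivalence (F n)) ∧
    (∀ n, MeasurableSet {p : (ℕ → Bool) × (ℕ → Bool) | F n p.1 p.2}) ∧
    (∀ n a b, F n a b → F (n + 1) a b) ∧
    (∀ a b, TuringEquiv a b ↔ ∃ n, F n a b) ∧
    (∀ n x y, TuringLE y x → (Set.range (column y)).Infinite →
      ¬ Set.range (column y) ⊆ {z | F n x z})


/-- Codes for partial functions recursive in an oracle. -/
inductive OracleCode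
  | zero | succ | left | right | oracle
  | pair (c d : OracleCode)
  | comp (c d : OracleCode)
  | prec (c d : OracleCode)
  | rfind (c : OracleCode)

/-- An injective numbering of the codes. -/
def OracleCode.toNat : OracleCode → ℕ
  | zero => Nat.pair 0 0
  | succ => Nat.pair 1 0
  | left => Nat.pair 2 0
  | right => Nat.pair 3 0
  | oracle => Nat.pair 4 0
  | pair c d => Nat.pair 5 (Nat.pair c.toNat d.toNat)
  | comp c d => Nat.pair 6 (Nat.pair c.toNat d.toNat)
  | prec c d => Nat.pair 7 (Nat.pair c.toNat d.toNat)
  | rfind c => Nat.pair 8 c.toNat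

theorem OracleCode.toNat_injective : Function.Injective toNat := by
  intro c
  induction c with
  | zero | succ | left | right | oracle => intro d h; cases d <;> simp_all [toNat, Nat.pair_eq_pair]
  | pair _ _ h₁ h₂ | comp _ _ h₁ h₂ | prec _ _ h₁ h₂ =>
    intro d h
    cases d <;> simp [toNat, Nat.pair_eq_pair] at h
    rw [h₁ h.1, h₂ h.2]
  | rfind _ h₁ =>
    intro d h
    cases d <;> simp [toNat, Nat.pair_eq_pair] at h
    rw [h₁ h]

instance : Countable OracleCode := OracleCode.toNat_injective.countable

/-- The partial function with code `c` relative to the oracle `O`. -/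
def OracleCode.eval (O : ℕ → ℕ) : OracleCode → ℕ →. ℕ
  | zero => pure 0
  | succ => fun n => Part.some (Nat.succ n)
  | left => fun n => Part.some (Nat.unpair n).1
  | right => fun n => Part.some (Nat.unpair n).2
  | oracle => fun n => Part.some (O n)
  | pair c d => fun n => Nat.pair <$> c.eval O n <*> d.eval O n
  | comp c d => fun n => d.eval O n >>= c.eval O
  | prec c d => Nat.unpaired fun a n =>
      n.rec (c.eval O a) fun y IH => do { let i ← IH; d.eval O (Nat.pair a (Nat.pair y i)) }
  | rfind c => fun a => Nat.rfind fun n => (fun m => m = 0) <$> c.eval O (Nat.pair a n)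

theorem RecursiveIn.exists_code {O : ℕ → ℕ} {f : ℕ →. ℕ} (hf : RecursiveIn O f) :
    ∃ c : OracleCode, c.eval O = f := by
  induction hf with
  | zero => exact ⟨.zero, rfl⟩
  | succ => exact ⟨.succ, rfl⟩
  | left => exact ⟨.left, rfl⟩
  | right => exact ⟨.right, rfl⟩
  | oracle => exact ⟨.oracle, rfl⟩
  | pair _ _ h₁ h₂ =>
    obtain ⟨c, rfl⟩ := h₁; obtain ⟨d, rfl⟩ := h₂; exact ⟨.pair c d, rfl⟩
  | comp _ _ h₁ h₂ =>
    obtain ⟨c, rfl⟩ := h₁; obtain ⟨d, rfl⟩ := h₂; exact ⟨.comp c d, rfl⟩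
  | prec _ _ h₁ h₂ =>
    obtain ⟨c, rfl⟩ := h₁; obtain ⟨d, rfl⟩ := h₂; exact ⟨.prec c d, rfl⟩
  | rfind _ h => obtain ⟨c, rfl⟩ := h; exact ⟨.rfind c, rfl⟩

theorem OracleCode.recursiveIn_eval (O : ℕ → ℕ) (c : OracleCode) : RecursiveIn O (c.eval O) := by
  induction c with
  | zero => exact .zero
  | succ => exact .succ
  | left => exact .left
  | right => exact .right
  | oracle => exact .oracle
  | pair _ _ h₁ h₂ => exact .pair h₁ h₂
  | comp _ _ h₁ h₂ => exact .comp h₁ h₂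
  | prec _ _ h₁ h₂ => exact .prec h₁ h₂
  | rfind _ h => exact .rfind h

theorem RecursiveIn.trans {O O' : ℕ → ℕ} {f : ℕ →. ℕ} (hf : RecursiveIn O f)
    (hO : RecursiveIn O' fun n => Part.some (O n)) : RecursiveIn O' f := by
  induction hf with
  | zero => exact .zero
  | succ => exact .succ
  | left => exact .left
  | right => exact .right
  | oracle => exact hO
  | pair _ _ h₁ h₂ => exact .pair h₁ h₂
  | comp _ _ h₁ h₂ => exact .comp h₁ h₂
  | prec _ _ h₁ h₂ => exact .prec h₁ h₂
  | rfind _ h => exact .rfind h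

theorem RecursiveIn.of_primrec (O : ℕ → ℕ) {f : ℕ → ℕ} (hf : Nat.Primrec f) :
    RecursiveIn O fun n => Part.some (f n) := by
  induction hf with
  | zero => exact .zero
  | succ => exact .succ
  | left => exact .left
  | right => exact .right
  | pair _ _ h₁ h₂ =>
    convert RecursiveIn.pair h₁ h₂ using 2
    simp [Seq.seq]
  | comp _ _ h₁ h₂ =>
    convert RecursiveIn.comp h₁ h₂ using 2
    simp
  | @prec f g _ _ h₁ h₂ =>
    refine Eq.mp (congrArg (RecursiveIn O) (funext fun n => ?_)) (RecursiveIn.prec h₁ h₂)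
    simp only [Nat.unpaired]
    induction (Nat.unpair n).2 with
    | zero => rfl
    | succ m ih => exact (congrArg (fun q : Part ℕ => q >>= _) ih).trans (Part.bind_some _ _)

theorem TuringLE.refl (x : ℕ → Bool) : TuringLE x x := .oracle

theorem TuringLE.trans {x y z : ℕ → Bool} (h₁ : TuringLE x y) (h₂ : TuringLE y z) :
    TuringLE x z :=
  RecursiveIn.trans h₁ h₂

theorem TuringLE.of_primrec {x y : ℕ → Bool} {ρ : ℕ → ℕ} (hρ : Nat.Primrec ρ)
    (h : ∀ n, x n = y (ρ n)) : TuringLE x y := by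
  unfold TuringLE
  convert RecursiveIn.comp RecursiveIn.oracle (RecursiveIn.of_primrec (oracleOf y) hρ) using 2
  simp [oracleOf, h]

theorem turingEquiv_equivalence : Equivalence TuringEquiv where
  refl x := ⟨.refl x, .refl x⟩
  symm h := ⟨h.2, h.1⟩
  trans h₁ h₂ := ⟨h₁.1.trans h₂.1, h₂.2.trans h₁.2⟩

theorem OracleCode.measurableSet_mem_eval {Ω : Type*} [MeasurableSpace Ω] {O : Ω → ℕ → ℕ}
    (hO : ∀ n, Measurable fun ω => O ω n) (c : OracleCode) (n v : ℕ) :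
    MeasurableSet {ω | v ∈ c.eval (O ω) n} := by
  induction c generalizing n v with
  | zero => exact MeasurableSet.const (v ∈ zero.eval 0 n)
  | succ => exact MeasurableSet.const (v ∈ succ.eval 0 n)
  | left => exact MeasurableSet.const (v ∈ left.eval 0 n)
  | right => exact MeasurableSet.const (v ∈ right.eval 0 n)
  | oracle =>
    simp only [eval, Part.mem_some_iff]
    exact measurableSet_eq_fun measurable_const (hO n)
  | pair c d hc hd =>
    have : {ω | v ∈ (pair c d).eval (O ω) n} =
        ⋃ a, ⋃ b, {ω | a ∈ c.eval (O ω) n} ∩ ({ω | b ∈ d.eval (O ω) n} ∩ {_ω | Nat.pair a b = v}) := by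
      ext ω
      simp [eval, Seq.seq]
    rw [this]
    exact .iUnion fun a => .iUnion fun b => (hc n a).inter ((hd n b).inter (.const _))
  | comp c d hc hd =>
    have : {ω | v ∈ (comp c d).eval (O ω) n} =
        ⋃ a, {ω | a ∈ d.eval (O ω) n} ∩ {ω | v ∈ c.eval (O ω) a} := by
      ext ω
      simp only [Set.mem_iUnion]
      exact Part.mem_bind_iff
    rw [this]
    exact .iUnion fun a => (hd n a).inter (hc a v)
  | prec c d hc hd =>
    simp only [eval, Nat.unpaired]
    generalize (Nat.unpair n).1 = a
    induction (Nat.unpair n).2 generalizing v with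
    | zero => exact hc a v
    | succ m ih =>
      simp only [Part.bind_eq_bind, Part.mem_bind_iff, Set.ofPred_exists, Set.ofPred_and]
      exact .iUnion fun i => (ih i).inter (hd _ v)
  | rfind c hc =>
    have : {ω | v ∈ (rfind c).eval (O ω) n} =
        {ω | 0 ∈ c.eval (O ω) (Nat.pair n v)} ∩
          ⋂ m : Fin v, ⋃ a, {ω | a + 1 ∈ c.eval (O ω) (Nat.pair n m)} := by
      ext ω
      simp only [Set.mem_ofPred_eq, Set.mem_inter_iff, Set.mem_iInter, Set.mem_iUnion,
        Fin.forall_iff]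
      refine Nat.mem_rfind.trans (and_congr ?_ (forall₂_congr fun m _ => ?_))
      · simp
      · simp only [Part.map_eq_map, Part.mem_map_iff, decide_eq_false_iff_not]
        exact ⟨fun ⟨a, ha, h⟩ => ⟨a - 1, by rwa [Nat.sub_add_cancel (Nat.pos_of_ne_zero h)]⟩,
          fun ⟨a, ha⟩ => ⟨a + 1, ha, a.succ_ne_zero⟩⟩
    rw [this]
    exact (hc _ 0).inter (.iInter fun m => .iUnion fun a => hc _ _)

theorem measurable_oracleOf (n : ℕ) : Measurable fun x : ℕ → Bool => oracleOf x n :=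
  (measurable_of_countable fun b : Bool => cond b 1 0).comp (measurable_pi_apply n)

theorem turingLE_iff_exists_code {z x : ℕ → Bool} :
    TuringLE z x ↔ ∃ c : OracleCode, ∀ n, oracleOf z n ∈ c.eval (oracleOf x) n := by
  constructor
  · intro h
    obtain ⟨c, hc⟩ := RecursiveIn.exists_code h
    exact ⟨c, fun n => by simp [hc]⟩
  · rintro ⟨c, hc⟩
    have : c.eval (oracleOf x) = fun n => Part.some (oracleOf z n) :=
      funext fun n => Part.eq_some_iff.2 (hc n)
    rw [TuringLE, ← this]
    exact c.recursiveIn_eval (oracleOf x)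

theorem measurableSet_turingLE :
    MeasurableSet {p : (ℕ → Bool) × (ℕ → Bool) | TuringLE p.1 p.2} := by
  have : {p : (ℕ → Bool) × (ℕ → Bool) | TuringLE p.1 p.2} = ⋃ c : OracleCode, ⋂ n, ⋃ v,
      {p | oracleOf p.1 n = v} ∩ {p | v ∈ c.eval (oracleOf p.2) n} := by
    ext p
    simp [turingLE_iff_exists_code]
  rw [this]
  exact .iUnion fun c => .iInter fun n => .iUnion fun v =>
    (measurableSet_eq_fun ((measurable_oracleOf n).comp measurable_fst) measurable_const).inter
      (c.measurableSet_mem_eval (fun n => (measurable_oracleOf n).comp measurable_snd) n v)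

/-- The real whose `n`th bit is `1` exactly when the code `c` with oracle `x` outputs `1` on `n`. -/
noncomputable def OracleCode.real (c : OracleCode) (x : ℕ → Bool) : ℕ → Bool :=
  fun n => decide (1 ∈ c.eval (oracleOf x) n)

theorem OracleCode.measurable_real (c : OracleCode) : Measurable c.real := by
  refine measurable_pi_lambda _ fun n => measurable_to_bool ?_
  simpa [Set.preimage, OracleCode.real] using c.measurableSet_mem_eval measurable_oracleOf n 1

theorem TuringLE.exists_real_eq {z x : ℕ → Bool} (h : TuringLE z x) :
    ∃ c : OracleCode, c.real x = z := by
  obtain ⟨c, hc⟩ := RecursiveIn.exists_code h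
  refine ⟨c, funext fun n => ?_⟩
  cases hz : z n <;> simp [OracleCode.real, hc, oracleOf, hz]

theorem hyperRecFin_of_hyperBorelFinite (h : HyperBorelFinite TuringEquiv) : HyperRecFin := by
  have : Nonempty OracleCode := ⟨.zero⟩
  obtain ⟨e, he⟩ := exists_surjective_nat OracleCode
  obtain ⟨F, h₁, h₂, h₃, h₄, h₅⟩ := h (fun i x => column ((e i).real x)) fun i =>
    measurable_pi_lambda _ fun j => measurable_pi_lambda _ fun m =>
      (measurable_pi_apply (Nat.pair j m)).comp (e i).measurable_real
  refine ⟨F, h₁, h₂, h₃, h₄, fun n x y hy hinf => ?_⟩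
  obtain ⟨c, rfl⟩ := hy.exists_real_eq
  obtain ⟨i, rfl⟩ := he c
  exact h₅ n x i hinf

theorem countable_turingEquiv (x : ℕ → Bool) : {y | TuringEquiv x y}.Countable :=
  (Set.countable_range fun c : OracleCode => c.real x).mono fun _ hy => hy.2.exists_real_eq

theorem measurableSet_turingEquiv :
    MeasurableSet {p : (ℕ → Bool) × (ℕ → Bool) | TuringEquiv p.1 p.2} :=
  measurableSet_turingLE.inter (measurable_swap measurableSet_turingLE)

section LusinNovikov

open MeasureTheory Filter Topology

/-- If `h` factors through `f` on a Borel set, then it does so via a Borel function. -/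
theorem exists_measurable_factor {X Z : Type*} [TopologicalSpace X] [PolishSpace X]
    [MeasurableSpace X] [BorelSpace X] [MeasurableSpace Z] [StandardBorelSpace Z] {S : Set Z}
    (hS : MeasurableSet S) {f : Z → X} (hf : Measurable f) {h : Z → ℕ → Bool} (hh : Measurable h)
    (hfh : ∀ z ∈ S, ∀ z' ∈ S, f z = f z' → h z = h z') :
    ∃ g : X → ℕ → Bool, Measurable g ∧ ∀ z ∈ S, h z = g (f z) := by
  have han : ∀ k b, AnalyticSet (f '' (S ∩ {z | h z k = b})) := fun k b =>
    (hS.inter (((measurable_pi_apply k).comp hh) (measurableSet_singleton b))).analyticSet_image hf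
  have hsep : ∀ k, MeasurablySeparable (f '' (S ∩ {z | h z k = true}))
      (f '' (S ∩ {z | h z k = false})) := by
    refine fun k => (han k true).measurablySeparable (han k false) (Set.disjoint_left.2 ?_)
    rintro _ ⟨z, ⟨hz, hk⟩, rfl⟩ ⟨z', ⟨hz', hk'⟩, hzz'⟩
    have h₁ : h z k = true := hk
    have h₂ : h z' k = false := hk'
    simp [← hfh _ hz' _ hz hzz', h₂] at h₁
  choose B hsub hdisj hB using hsep
  refine ⟨fun x k => decide (x ∈ B k), measurable_pi_lambda _ fun k => measurable_to_bool ?_, ?_⟩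
  · simpa [Set.preimage] using hB k
  · intro z hz
    funext k
    cases hk : h z k
    · have : f z ∉ B k := Set.disjoint_left.1 (hdisj k) ⟨z, ⟨hz, hk⟩, rfl⟩
      simp [this]
    · have : f z ∈ B k := hsub k ⟨z, ⟨hz, hk⟩, rfl⟩
      simp [this]

/-- A set of pairs is a σ-graph if it is covered by the graphs of countably many Borel
functions. -/
def IsSigmaGraph {X : Type*} [MeasurableSpace X] (G : Set (X × (ℕ → Bool))) : Prop :=
  ∃ g : ℕ → X → ℕ → Bool, (∀ n, Measurable (g n)) ∧ G = {p | ∃ n, p.2 = g n p.1}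

theorem IsSigmaGraph.measurableSet {X : Type*} [MeasurableSpace X] {G : Set (X × (ℕ → Bool))}
    (hG : IsSigmaGraph G) : MeasurableSet G := by
  obtain ⟨g, hg, rfl⟩ := hG
  rw [Set.ofPred_exists]
  exact .iUnion fun n => measurableSet_eq_fun measurable_snd ((hg n).comp measurable_fst)

theorem IsSigmaGraph.iUnion {X ι : Type*} [MeasurableSpace X] [Countable ι] [Nonempty ι]
    {G : ι → Set (X × (ℕ → Bool))} (hG : ∀ i, IsSigmaGraph (G i)) : IsSigmaGraph (⋃ i, G i) := by
  choose g hg hG using hG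
  obtain ⟨e, he⟩ := exists_surjective_nat (ι × ℕ)
  refine ⟨fun n => g (e n).1 (e n).2, fun n => hg _ _, Set.ext fun p => ?_⟩
  simp only [hG, Set.mem_iUnion, Set.mem_ofPred_eq]
  refine ⟨fun ⟨i, n, h⟩ => ?_, fun ⟨n, h⟩ => ⟨_, _, h⟩⟩
  obtain ⟨m, hm⟩ := he (i, n)
  exact ⟨m, by rw [hm]; exact h⟩

theorem isSigmaGraph_graph {X : Type*} [MeasurableSpace X] {g : X → ℕ → Bool} (hg : Measurable g) :
    IsSigmaGraph {p : X × (ℕ → Bool) | p.2 = g p.1} :=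
  ⟨fun _ => g, fun _ => hg, by simp⟩

/-- Finite approximations to a perfect set: a pair `(α, k)` consists of points `α i` of Baire space
and of places `k m` at which the values at two of these points differ. -/
abbrev Config : Type := (ℕ → ℕ → ℕ) × (ℕ → ℕ)

/-- The part of a configuration seen at level `n`. -/
def Config.restrict (n : ℕ) (c : Config) : (Fin (n + 1) → Fin n → ℕ) × (Fin n → ℕ) :=
  (fun i j => c.1 i j, fun m => c.2 m)

theorem Config.restrict_eq_iff {n : ℕ} {c d : Config} : c.restrict n = d.restrict n ↔
    (∀ i ≤ n, ∀ j < n, c.1 i j = d.1 i j) ∧ ∀ m < n, c.2 m = d.2 m := by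
  simp [Config.restrict, funext_iff, Fin.forall_iff]

/-- At level `n` the points `α 0, …, α n` of the configuration have `φ`-values in `Q` with the same
first coordinate; moreover `α (m + 1)` agrees with `α p` up to `m`, where `p` is the left
component of `m`, but its `φ`-value has another second coordinate. -/
def Config.Valid {X : Type*} (φ : (ℕ → ℕ) → X × (ℕ → Bool)) (Q : Set (X × (ℕ → Bool))) (n : ℕ)
    (c : Config) : Prop :=
  (∀ i ≤ n, φ (c.1 i) ∈ Q ∧ (φ (c.1 i)).1 = (φ (c.1 0)).1) ∧
  ∀ m < n, (∀ j < m, c.1 (m + 1) j = c.1 m.unpair.1 j) ∧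
    (φ (c.1 (m + 1))).2 (c.2 m) ≠ (φ (c.1 m.unpair.1)).2 (c.2 m)

/-- The level `n` part of `c` is small if removing countably many Borel graphs leaves no valid
configuration extending it. -/
def Config.Small {X : Type*} [MeasurableSpace X] (φ : (ℕ → ℕ) → X × (ℕ → Bool)) (n : ℕ)
    (c : Config) : Prop :=
  ∃ G, IsSigmaGraph G ∧ ∀ d : Config, d.restrict n = c.restrict n → ¬ d.Valid φ Gᶜ n

theorem Config.exists_isSigmaGraph_forall_small {X : Type*} [MeasurableSpace X]
    (φ : (ℕ → ℕ) → X × (ℕ → Bool)) :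
    ∃ G, IsSigmaGraph G ∧ ∀ n (c : Config), c.Small φ n → ¬ c.Valid φ Gᶜ n := by
  have key : ∀ i : Σ n : ℕ, (Fin (n + 1) → Fin n → ℕ) × (Fin n → ℕ), ∃ G, IsSigmaGraph G ∧
      ∀ c : Config, c.restrict i.1 = i.2 → c.Small φ i.1 → ¬ c.Valid φ Gᶜ i.1 := by
    rintro ⟨n, r⟩
    by_cases h : ∃ c : Config, c.restrict n = r ∧ c.Small φ n
    · obtain ⟨c, rfl, G, hG, hc⟩ := h
      exact ⟨G, hG, fun d hd _ => hc d hd⟩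
    · exact ⟨_, isSigmaGraph_graph (g := fun _ _ => true) measurable_const,
        fun c hc hs => (h ⟨c, hc, hs⟩).elim⟩
  choose G hG hval using key
  refine ⟨⋃ i, G i, .iUnion hG, fun n c hc hv => hval ⟨n, c.restrict n⟩ c rfl hc ?_⟩
  exact ⟨fun i hi => ⟨fun h => (hv.1 i hi).1 (Set.mem_iUnion.2 ⟨_, h⟩), (hv.1 i hi).2⟩, hv.2⟩

variable {X : Type*} [TopologicalSpace X] [PolishSpace X] [MeasurableSpace X] [BorelSpace X]

theorem Config.measurableSet_valid {φ : (ℕ → ℕ) → X × (ℕ → Bool)} (hφ : Continuous φ)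
    {Q : Set (X × (ℕ → Bool))} (hQ : MeasurableSet Q) (n : ℕ) :
    MeasurableSet {c : Config | c.Valid φ Q n} := by
  have hval : ∀ i, Measurable fun c : Config => φ (c.1 i) := fun i =>
    hφ.measurable.comp ((measurable_pi_apply i).comp measurable_fst)
  have hbit : ∀ m i, Measurable fun c : Config => (φ (c.1 i)).2 (c.2 m) := fun m i => by
    have : Measurable fun q : (ℕ → Bool) × ℕ => q.1 q.2 :=
      measurable_from_prod_countable_left fun k => measurable_pi_apply k
    exact this.comp ((measurable_snd.comp (hval i)).prodMk
      ((measurable_pi_apply m).comp measurable_snd))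
  have hent : ∀ i j, Measurable fun c : Config => c.1 i j := fun i j =>
    (measurable_pi_apply j).comp ((measurable_pi_apply i).comp measurable_fst)
  simp only [Config.Valid, Set.ofPred_and, Set.ofPred_forall]
  refine .inter (.iInter fun i => .iInter fun _ => .inter (hval i hQ) ?_)
    (.iInter fun m => .iInter fun _ => .inter (.iInter fun j => .iInter fun _ => ?_) ?_)
  · exact measurableSet_eq_fun (measurable_fst.comp (hval i)) (measurable_fst.comp (hval 0))
  · exact measurableSet_eq_fun (hent _ _) (hent _ _)
  · exact (measurableSet_eq_fun (hbit _ _) (hbit _ _)).compl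

theorem Config.exists_not_small_succ {φ : (ℕ → ℕ) → X × (ℕ → Bool)}
    (hφ : Continuous φ) {n : ℕ} {c : Config} (hc : ¬ c.Small φ n) :
    ∃ d : Config, d.restrict n = c.restrict n ∧ ¬ d.Small φ (n + 1) := by
  by_contra! hsmall
  obtain ⟨G, hG, hGval⟩ := Config.exists_isSigmaGraph_forall_small φ
  let p := n.unpair.1
  have hpn : p ≤ n := n.unpair_left_le
  set S : Set Config := {d | d.restrict n = c.restrict n ∧ d.Valid φ Gᶜ n} with hS
  have hmeas : MeasurableSet S := by
    refine .inter ?_ (Config.measurableSet_valid hφ hG.measurableSet.compl n)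
    have : Measurable (Config.restrict n) :=
      (measurable_pi_lambda _ fun i => measurable_pi_lambda _ fun j =>
        (measurable_pi_apply _).comp ((measurable_pi_apply _).comp measurable_fst)).prodMk
      (measurable_pi_lambda _ fun m => (measurable_pi_apply _).comp measurable_snd)
    exact this (measurableSet_singleton _)
  have hφp : Measurable fun d : Config => φ (d.1 p) :=
    hφ.measurable.comp ((measurable_pi_apply p).comp measurable_fst)
  obtain ⟨g, hg, hgA⟩ := exists_measurable_factor hmeas hφp.fst hφp.snd (by
    rintro d ⟨hd, hdv⟩ d' ⟨hd', hdv'⟩ hdd'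
    by_contra hne
    obtain ⟨k, hk⟩ := Function.ne_iff.1 hne
    let e : Config := (Function.update d.1 (n + 1) (d'.1 p), Function.update d.2 n k)
    have e₁ : ∀ i ≤ n, e.1 i = d.1 i := fun i hi => Function.update_of_ne (by omega) _ _
    have e₂ : ∀ m < n, e.2 m = d.2 m := fun m hm => Function.update_of_ne (by omega) _ _
    have e₃ : e.1 (n + 1) = d'.1 p := Function.update_self _ _ _
    have e₄ : e.2 n = k := Function.update_self _ _ _
    have hed : e.restrict n = d.restrict n :=
      Config.restrict_eq_iff.2 ⟨fun i hi j _ => by rw [e₁ i hi], e₂⟩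
    refine hGval (n + 1) e (hsmall e (hed.trans hd)) ⟨fun i hi => ?_, fun m hm => ?_⟩
    · rw [e₁ 0 n.zero_le]
      rcases Nat.le_succ_iff.1 hi with hi | rfl
      · rw [e₁ i hi]
        exact hdv.1 i hi
      · rw [e₃]
        refine ⟨(hdv'.1 p hpn).1, ?_⟩
        rw [← (hdv.1 p hpn).2, hdd']
    · have hm' : m.unpair.1 ≤ n := m.unpair_left_le.trans (Nat.lt_succ_iff.1 hm)
      rw [e₁ _ hm']
      rcases Nat.lt_succ_iff_lt_or_eq.1 hm with hm | rfl
      · rw [e₁ _ hm, e₂ m hm]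
        exact hdv.2 m hm
      · rw [e₃, e₄]
        refine ⟨fun j hj => ?_, Ne.symm hk⟩
        exact (Config.restrict_eq_iff.1 (hd'.trans hd.symm)).1 p hpn j hj)
  refine hc ⟨G ∪ {q | q.2 = g q.1}, ?_, fun d hd hdv => ?_⟩
  · rw [Set.union_eq_iUnion]
    exact .iUnion fun b => by cases b; exacts [isSigmaGraph_graph hg, hG]
  · refine (hdv.1 p hpn).1 (.inr (hgA d ⟨hd, ?_⟩))
    exact ⟨fun i hi => ⟨fun h => (hdv.1 i hi).1 (.inl h), (hdv.1 i hi).2⟩, hdv.2⟩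

theorem not_countable_of_perfect {Y : Type*} [TopologicalSpace Y] [T1Space Y] {ψ : (ℕ → ℕ) → Y}
    (hψ : Continuous ψ) (α : ℕ → ℕ → ℕ)
    (hα : ∀ m, (∀ j < m, α (m + 1) j = α m.unpair.1 j) ∧ ψ (α (m + 1)) ≠ ψ (α m.unpair.1)) :
    ¬ (ψ '' closure (Set.range α)).Countable := by
  intro hcount
  let K := closure (Set.range α)
  have : IsClosed K := isClosed_closure
  have : PolishSpace K := this.polishSpace
  have : Nonempty K := ⟨⟨α 0, subset_closure ⟨0, rfl⟩⟩⟩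
  have : Countable (ψ '' K) := hcount
  obtain ⟨⟨y, hy⟩, ⟨β, hβ⟩⟩ := nonempty_interior_of_iUnion_of_closed
    (f := fun y : ψ '' K => {β : K | ψ β = y})
    (fun y => (isClosed_singleton (x := (y : Y))).preimage (hψ.comp continuous_subtype_val))
    (Set.eq_univ_of_forall fun β => Set.mem_iUnion.2 ⟨⟨ψ β, β, β.2, rfl⟩, rfl⟩)
  obtain ⟨U, hU, hUsub⟩ := mem_nhds_subtype _ _ _ |>.1 (mem_interior_iff_mem_nhds.1 hβ)
  obtain ⟨V, hVU, hV, hβV⟩ := mem_nhds_iff.1 hU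
  obtain ⟨_, hiV, ⟨i, rfl⟩⟩ := mem_closure_iff.1 β.2 V hV hβV
  have hlim : Tendsto (fun l => α (Nat.pair i l + 1)) atTop (𝓝 (α i)) := by
    refine tendsto_pi_nhds.2 fun j => tendsto_const_nhds.congr' ?_
    filter_upwards [eventually_gt_atTop j] with l hl
    have := (hα (Nat.pair i l)).1 j (hl.trans_le (Nat.right_le_pair i l))
    simpa using this.symm
  obtain ⟨l, hl⟩ := (hlim.eventually (hV.mem_nhds hiV)).exists
  have h₁ : ∀ k, α k ∈ V → ψ (α k) = y := fun k hk =>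
    hUsub (a := ⟨α k, subset_closure ⟨k, rfl⟩⟩) (hVU hk)
  refine (hα (Nat.pair i l)).2 ?_
  rw [h₁ _ hl, Nat.unpair_pair, h₁ i hiV]

/-- The **Lusin–Novikov theorem**: a Borel set with countable vertical sections is covered by the
graphs of countably many Borel functions. -/
theorem exists_measurable_of_countable_sections {P : Set (X × (ℕ → Bool))} (hP : MeasurableSet P)
    (hcount : ∀ x, {y | (x, y) ∈ P}.Countable) :
    ∃ g : ℕ → X → ℕ → Bool, (∀ n, Measurable (g n)) ∧ ∀ p ∈ P, ∃ n, p.2 = g n p.1 := by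
  rcases P.eq_empty_or_nonempty with rfl | hne
  · exact ⟨fun _ _ _ => true, fun _ => measurable_const, by simp⟩
  have hana : AnalyticSet P := by
    simpa using hP.analyticSet_image measurable_id
  rw [AnalyticSet] at hana
  obtain ⟨φ, hφ, rfl⟩ := hana.resolve_left hne.ne_empty
  by_cases hroot : Config.Small φ 0 0
  · obtain ⟨_, ⟨g, hg, rfl⟩, h⟩ := hroot
    refine ⟨g, hg, ?_⟩
    rintro _ ⟨β, rfl⟩
    by_contra hβ
    exact h (fun _ => β, 0) (Config.restrict_eq_iff.2 (by simp)) ⟨by simpa using hβ, by simp⟩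
  exfalso
  have step : ∀ n (c : {c : Config // ¬ c.Small φ n}), ∃ d : {d : Config // ¬ d.Small φ (n + 1)},
      d.1.restrict n = c.1.restrict n := fun n c =>
    let ⟨d, hd, hs⟩ := Config.exists_not_small_succ hφ c.2
    ⟨⟨d, hs⟩, hd⟩
  choose next hnext using step
  let C : ∀ n, {c : Config // ¬ c.Small φ n} := fun n => Nat.rec ⟨0, hroot⟩ next n
  have hC : ∀ n, (C (n + 1)).1.restrict n = (C n).1.restrict n := fun n => hnext n (C n)
  have hval : ∀ n, ∃ d : Config, d.restrict n = (C n).1.restrict n ∧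
      d.Valid φ (Set.range φ) n := by
    intro n
    by_contra! h
    refine (C n).2 ⟨_, isSigmaGraph_graph (g := fun _ _ => true) measurable_const, ?_⟩
    exact fun d hd hv => h d hd ⟨fun i hi => ⟨⟨_, rfl⟩, (hv.1 i hi).2⟩, hv.2⟩
  choose D hDC hD using hval
  let c : Config := (fun i j => (C (i + j + 1)).1.1 i j, fun m => (C (m + 1)).1.2 m)
  have hmono : ∀ n N, n ≤ N → (C N).1.restrict n = (C n).1.restrict n := by
    intro n N hN
    induction N, hN using Nat.le_induction with
    | base => rfl
    | succ N hN ih =>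
      rw [← ih]
      have := Config.restrict_eq_iff.1 (hC N)
      exact Config.restrict_eq_iff.2 ⟨fun i hi j hj => this.1 i (by omega) j (by omega),
        fun m hm => this.2 m (by omega)⟩
  have hα : ∀ n i j, i + j < n → (D n).1 i j = c.1 i j := by
    intro n i j h
    rw [(Config.restrict_eq_iff.1 (hDC n)).1 i (by omega) j (by omega)]
    exact (Config.restrict_eq_iff.1 (hmono (i + j + 1) n h)).1 i (by omega) j (by omega)
  have hk : ∀ n m, m < n → (D n).2 m = c.2 m := by
    intro n m h
    rw [(Config.restrict_eq_iff.1 (hDC n)).2 m h]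
    exact (Config.restrict_eq_iff.1 (hmono (m + 1) n h)).2 m (by omega)
  have hlim : ∀ i, Tendsto (fun n => φ ((D n).1 i)) atTop (𝓝 (φ (c.1 i))) := by
    refine fun i => (hφ.tendsto _).comp (tendsto_pi_nhds.2 fun j => tendsto_const_nhds.congr' ?_)
    filter_upwards [eventually_gt_atTop (i + j)] with n hn using (hα n i j hn).symm
  have hx : ∀ i, (φ (c.1 i)).1 = (φ (c.1 0)).1 := by
    refine fun i => tendsto_nhds_unique ((continuous_fst.tendsto _).comp (hlim i)) ?_
    refine ((continuous_fst.tendsto _).comp (hlim 0)).congr' ?_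
    filter_upwards [eventually_ge_atTop i] with n hn using ((hD n).1 i hn).2.symm
  have hbit : ∀ m i, Tendsto (fun n => (φ ((D n).1 i)).2 (c.2 m)) atTop
      (𝓝 ((φ (c.1 i)).2 (c.2 m))) := fun m i =>
    (((continuous_apply (c.2 m)).comp continuous_snd).tendsto _).comp (hlim i)
  refine not_countable_of_perfect (continuous_snd.comp hφ) c.1 (fun m => ⟨fun j hj => ?_, ?_⟩)
    ((hcount (φ (c.1 0)).1).mono ?_)
  · have hm := m.unpair_left_le
    rw [← hα (m + j + 2) (m + 1) j (by omega), ← hα (m + j + 2) m.unpair.1 j (by omega)]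
    exact ((hD _).2 m (by omega)).1 j hj
  · intro heq
    have h₁ := hbit m (m + 1)
    have h₂ := hbit m m.unpair.1
    have heq' : (φ (c.1 (m + 1))).2 (c.2 m) = (φ (c.1 m.unpair.1)).2 (c.2 m) :=
      congrFun heq (c.2 m)
    rw [← heq'] at h₂
    rw [nhds_discrete, tendsto_pure] at h₁ h₂
    obtain ⟨n, ⟨hn₁, hn₂⟩, hn⟩ := ((h₁.and h₂).and (eventually_gt_atTop m)).exists
    refine ((hD n).2 m hn).2 ?_
    rw [hk n m hn, hn₁]
    exact hn₂.symm
  · rintro _ ⟨β, hβ, rfl⟩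
    refine ⟨β, Prod.ext ?_ rfl⟩
    refine closure_minimal ?_ ((isClosed_singleton (x := (φ (c.1 0)).1)).preimage
      (continuous_fst.comp hφ)) hβ
    rintro _ ⟨i, rfl⟩
    exact hx i

end LusinNovikov

theorem exists_measurable_enumeration {X : Type*} [MeasurableSpace X] [StandardBorelSpace X]
    {E : X → X → Prop} (hE : MeasurableSet {p : X × X | E p.1 p.2})
    (hcount : ∀ x, {y | E x y}.Countable) :
    ∃ g : ℕ → X → X, (∀ n, Measurable (g n)) ∧ ∀ x y, E x y → ∃ n, y = g n x := by
  cases isEmpty_or_nonempty X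
  · exact ⟨fun _ => id, fun _ => measurable_id, fun x => isEmptyElim x⟩
  let := upgradeStandardBorel X
  obtain ⟨c, hc, hinj⟩ := MeasurableSpace.measurable_injection_nat_bool_of_countablySeparated X
  have hemb := hc.measurableEmbedding hinj
  obtain ⟨r, hr, hrc⟩ := hemb.exists_measurable_extend measurable_id fun _ => inferInstance
  have hrc' : ∀ x, r (c x) = x := congrFun hrc
  let q : X × X → X × (ℕ → Bool) := fun p => (p.1, c p.2)
  obtain ⟨g, hg, hgE⟩ := exists_measurable_of_countable_sections (P := q '' {p | E p.1 p.2})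
    (hE.image_of_measurable_injOn (measurable_fst.prodMk (hc.comp measurable_snd))
      (fun p _ p' _ h => Prod.ext (Prod.ext_iff.1 h).1 (hinj (Prod.ext_iff.1 h).2)))
    (fun x => ((hcount x).image c).mono (by
      rintro _ ⟨⟨x', y⟩, hxy, h⟩
      obtain ⟨rfl, rfl⟩ := Prod.ext_iff.1 h
      exact ⟨y, hxy, rfl⟩))
  refine ⟨fun n x => r (g n x), fun n => hr.comp (hg n), fun x y hxy => ?_⟩
  obtain ⟨n, hn⟩ := hgE (x, c y) ⟨(x, y), hxy, rfl⟩
  exact ⟨n, (hrc' y).symm.trans (congrArg r hn)⟩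

/-- The composition of maps from the sequence `s` given by the word with code `w`; the rightmost
map, applied first, comes first in the code. -/
def wordMap {X : Type*} (s : ℕ → X → X) : ℕ → X → X
  | 0 => id
  | w + 1 =>
    have : w.unpair.2 < w + 1 := Nat.lt_succ_of_le w.unpair_right_le
    wordMap s w.unpair.2 ∘ s w.unpair.1

theorem wordMap_pair_succ {X : Type*} (s : ℕ → X → X) (k w : ℕ) :
    wordMap s (Nat.pair k w + 1) = wordMap s w ∘ s k := by
  rw [wordMap, Nat.unpair_pair]

theorem measurable_wordMap {X : Type*} [MeasurableSpace X] {s : ℕ → X → X}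
    (hs : ∀ k, Measurable (s k)) (w : ℕ) : Measurable (wordMap s w) := by
  induction w using Nat.strong_induction_on with
  | _ w ih =>
    cases w with
    | zero => simpa [wordMap] using measurable_id
    | succ w =>
      rw [wordMap]
      exact (ih _ (Nat.lt_succ_of_le w.unpair_right_le)).comp (hs _)

/-- The join of the `c`-codes of all the images of `x` under words in the maps `s k`. -/
def wordJoin {X : Type*} (c : X → ℕ → Bool) (s : ℕ → X → X) (x : X) : ℕ → Bool :=
  joinSeq fun w => c (wordMap s w x)

theorem measurable_wordJoin {X : Type*} [MeasurableSpace X] {c : X → ℕ → Bool} (hc : Measurable c)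
    {s : ℕ → X → X} (hs : ∀ k, Measurable (s k)) : Measurable (wordJoin c s) :=
  measurable_pi_lambda _ fun m => (measurable_pi_apply m.unpair.2).comp
    (hc.comp (measurable_wordMap hs m.unpair.1))

theorem wordJoin_injective {X : Type*} {c : X → ℕ → Bool} (hc : Function.Injective c)
    (s : ℕ → X → X) : Function.Injective (wordJoin c s) := by
  refine fun x y h => hc (funext fun m => ?_)
  simpa [wordJoin, joinSeq, wordMap] using congrFun h (Nat.pair 0 m)

theorem wordJoin_apply_map {X : Type*} (c : X → ℕ → Bool) (s : ℕ → X → X) (k : ℕ) (x : X) (m : ℕ) :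
    wordJoin c s (s k x) m =
      wordJoin c s x (Nat.pair (Nat.pair k m.unpair.1 + 1) m.unpair.2) := by
  simp [wordJoin, joinSeq, wordMap_pair_succ]

theorem turingLE_joinSeq_wordJoin {X : Type*} (c : X → ℕ → Bool) (s : ℕ → X → X) (x : X)
    {ρ : ℕ → ℕ} (hρ : Primrec ρ) :
    TuringLE (joinSeq fun j => wordJoin c s (s (ρ j) x)) (wordJoin c s x) := by
  refine .of_primrec (ρ := fun n => Nat.pair
    (Nat.pair (ρ n.unpair.1) n.unpair.2.unpair.1 + 1) n.unpair.2.unpair.2) ?_ fun n => ?_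
  · have h₁ : Primrec fun n : ℕ => n.unpair.1 := Primrec.fst.comp Primrec.unpair
    have h₂ : Primrec fun n : ℕ => n.unpair.2 := Primrec.snd.comp Primrec.unpair
    exact Primrec.nat_iff.1 (Primrec₂.natPair.comp
      (Primrec.succ.comp (Primrec₂.natPair.comp (hρ.comp h₁) (h₁.comp h₂))) (h₂.comp h₂))
  · exact wordJoin_apply_map c s _ x _

theorem column_joinSeq (z : ℕ → ℕ → Bool) : column (joinSeq z) = z := by
  funext j m
  simp [column, joinSeq]

theorem turingLE_column (y : ℕ → Bool) (j : ℕ) : TuringLE (column y j) y :=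
  .of_primrec (Primrec.nat_iff.1 (Primrec₂.natPair.comp (.const j) .id)) fun _ => rfl

theorem turingLE_wordJoin {X : Type*} (c : X → ℕ → Bool) (s : ℕ → X → X) (k : ℕ) (x : X) :
    TuringLE (wordJoin c s (s k x)) (wordJoin c s x) := by
  have := turingLE_column (joinSeq fun j => wordJoin c s (s j x)) k
  rw [column_joinSeq] at this
  exact this.trans (turingLE_joinSeq_wordJoin c s x .id)

theorem HyperRecFin.hyperBorelFinite (h : HyperRecFin) {X : Type*} [MeasurableSpace X]
    [StandardBorelSpace X] {E : X → X → Prop} (hE : Equivalence E)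
    (hEm : MeasurableSet {p : X × X | E p.1 p.2}) (hcount : ∀ x, {y | E x y}.Countable) :
    HyperBorelFinite E := by
  intro f hf
  obtain ⟨F, hFe, hFm, hFmono, hFT, hFfin⟩ := h
  obtain ⟨g, hg, hgE⟩ := exists_measurable_enumeration hEm hcount
  obtain ⟨c, hc, hinj⟩ := MeasurableSpace.measurable_injection_nat_bool_of_countablySeparated X
  let s : ℕ → X → X := fun k x =>
    Nat.casesOn k.unpair.1 (g k.unpair.2 x) fun i => f i x k.unpair.2
  have hs₀ : ∀ n, s (Nat.pair 0 n) = g n := fun n => by simp [s]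
  have hs₁ : ∀ i j x, s (Nat.pair (i + 1) j) x = f i x j := fun i j x => by simp [s]
  have hs : ∀ k, Measurable (s k) := by
    intro k
    simp only [s]
    cases k.unpair.1 with
    | zero => exact hg _
    | succ i => exact (measurable_pi_apply _).comp (hf i)
  let φ := wordJoin c s
  have hφ : Measurable φ := measurable_wordJoin hc hs
  have hφinj : Function.Injective φ := wordJoin_injective hinj s
  have hle : ∀ x y, E x y → TuringLE (φ y) (φ x) := by
    intro x y hxy
    obtain ⟨n, rfl⟩ := hgE x y hxy
    rw [← hs₀]
    exact turingLE_wordJoin c s _ x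
  refine ⟨fun n x y => E x y ∧ F n (φ x) (φ y), fun n => ⟨fun x => ⟨hE.refl x, (hFe n).refl _⟩,
    fun h => ⟨hE.symm h.1, (hFe n).symm h.2⟩,
    fun h h' => ⟨hE.trans h.1 h'.1, (hFe n).trans h.2 h'.2⟩⟩,
    fun n => hEm.inter ((hφ.prodMap hφ) (hFm n)),
    fun n x y h => ⟨h.1, hFmono n _ _ h.2⟩, fun x y => ⟨fun hxy => ?_, fun ⟨_, h⟩ => h.1⟩,
    fun n x i hinf hsub => ?_⟩
  · obtain ⟨n, hn⟩ := (hFT _ _).1 ⟨hle y x (hE.symm hxy), hle x y hxy⟩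
    exact ⟨n, hxy, hn⟩
  · have hcol : Set.range (column (joinSeq fun j => φ (f i x j))) = φ '' Set.range (f i x) := by
      rw [column_joinSeq, ← Set.range_comp]
      rfl
    refine hFfin n (φ x) (joinSeq fun j => φ (f i x j)) ?_ ?_ ?_
    · simpa only [hs₁] using turingLE_joinSeq_wordJoin c s x
        (ρ := Nat.pair (i + 1)) (Primrec₂.natPair.comp (.const _) .id)
    · rw [hcol]
      exact hinf.image hφinj.injOn
    · rw [hcol]
      rintro _ ⟨z, hz, rfl⟩
      exact (hsub hz).2

/-- The following are equivalent: (1) Turing equivalence on `2^ω` is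
hyper-recursively-finite; (2) every countable Borel equivalence relation on a
standard Borel space is hyper-Borel-finite. -/
theorem hyperRecFin_iff_every_cber_hyperBorelFinite :
    HyperRecFin ↔
      ∀ (X : Type) [MeasurableSpace X] [StandardBorelSpace X] (E : X → X → Prop),
        Equivalence E →
        MeasurableSet {p : X × X | E p.1 p.2} →
        (∀ x, {y | E x y}.Countable) →
        HyperBorelFinite E :=
  ⟨fun h _ _ _ _ hE hEm hcount => h.hyperBorelFinite hE hEm hcount, fun h =>
    hyperRecFin_of_hyperBorelFinite (h (ℕ → Bool) TuringEquiv turingEquiv_equivalence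
      measurableSet_turingEquiv countable_turingEquiv)⟩

end SlamanSteel
end

section
/- Suppose (X,μ) is a standard probability space, Y is a finite set with |Y| = n, k ≤ n, m ∈ ℕ, and g : X → [Y]^k is a measurable function assigning to each x ∈ X a subset of Y of size exactly k. Then there is a set S ⊆ Y with |S| ≤ m such that μ({x ∈ X : g(x) ∩ S ≠ ∅}) ≥ 1 − (1 − k/n)^m. -/
open MeasureTheory

section UniformFinsetMap

variable {X Y : Type*} [MeasurableSpace X] [Fintype Y] {g : X → Finset Y}

theorem measurableSet_setOf_finset_map (hg : ∀ A : Finset Y, MeasurableSet (g ⁻¹' {A}))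
    (p : Finset Y → Prop) : MeasurableSet {x | p (g x)} := by
  let _ : MeasurableSpace (Finset Y) := ⊤
  exact measurable_to_countable' hg (MeasurableSpace.measurableSet_top (s := {A | p A}))

variable [DecidableEq Y]

/-- Double counting: the events `y ∈ g x` cover each point exactly `k` times. -/
theorem sum_measure_mem_finset_map (ν : Measure X)
    (hg : ∀ A : Finset Y, MeasurableSet (g ⁻¹' {A})) {k : ℕ} (hk : ∀ x, (g x).card = k) :
    ∑ y, ν {x | y ∈ g x} = k * ν Set.univ := by
  have hm (y : Y) : MeasurableSet {x | y ∈ g x} := measurableSet_setOf_finset_map hg (y ∈ ·)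
  calc
    ∑ y, ν {x | y ∈ g x} = ∑ y, ∫⁻ x, {x | y ∈ g x}.indicator 1 x ∂ν := by
      simp only [lintegral_indicator_one (hm _)]
    _ = ∫⁻ x, ∑ y, {x | y ∈ g x}.indicator 1 x ∂ν :=
      (lintegral_finsetSum _ fun y _ => measurable_one.indicator (hm y)).symm
    _ = ∫⁻ _, (k : ENNReal) ∂ν := by
      congr with x
      simp [Set.indicator_apply, hk]
    _ = k * ν Set.univ := lintegral_const _

/-- Some `y` lies in `g x` for at least a `k / |Y|` fraction of the points `x`. -/
theorem exists_le_measureReal_mem_finset_map [Nonempty Y] (ν : Measure X) [IsFiniteMeasure ν]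
    (hg : ∀ A : Finset Y, MeasurableSet (g ⁻¹' {A})) {k : ℕ} (hk : ∀ x, (g x).card = k) :
    ∃ y, (k : ℝ) / Fintype.card Y * ν.real Set.univ ≤ ν.real {x | y ∈ g x} := by
  have hsum : ∑ y, ν.real {x | y ∈ g x} = k * ν.real Set.univ := by
    simp only [measureReal_def]
    rw [← ENNReal.toReal_sum fun y _ => measure_ne_top _ _, sum_measure_mem_finset_map ν hg hk]
    simp
  obtain ⟨y, -, hy⟩ := Finset.exists_le_of_sum_le Finset.univ_nonempty
    (f := fun _ : Y => (k : ℝ) / Fintype.card Y * ν.real Set.univ)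
    (g := fun y => ν.real {x | y ∈ g x}) (by
      have : (Fintype.card Y : ℝ) ≠ 0 := by simp
      rw [hsum, Finset.sum_const, Finset.card_univ, nsmul_eq_mul]
      apply le_of_eq
      field_simp)
  exact ⟨y, hy⟩

/-- Choosing the elements of `S` greedily, each one captures at least a `k / |Y|` fraction of the
points `x` whose set `g x` has not been met yet. -/
theorem exists_measureReal_disjoint_finset_map_le [Nonempty Y] (μ : Measure X)
    [IsProbabilityMeasure μ] (hg : ∀ A : Finset Y, MeasurableSet (g ⁻¹' {A})) {k : ℕ}
    (hkY : k ≤ Fintype.card Y) (hk : ∀ x, (g x).card = k) (m : ℕ) :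
    ∃ S : Finset Y, S.card ≤ m ∧
      μ.real {x | Disjoint (g x) S} ≤ (1 - (k : ℝ) / Fintype.card Y) ^ m := by
  induction m with
  | zero => exact ⟨∅, by simp⟩
  | succ m ih =>
    obtain ⟨S, hS, hD⟩ := ih
    set D := {x | Disjoint (g x) S}
    obtain ⟨y, hy⟩ := exists_le_measureReal_mem_finset_map (μ.restrict D) hg hk
    have hm : MeasurableSet {x | y ∈ g x} := measurableSet_setOf_finset_map hg (y ∈ ·)
    refine ⟨insert y S, (Finset.card_insert_le _ _).trans (by lia), ?_⟩
    have hdiff : {x | Disjoint (g x) (insert y S)} = D \ {x | y ∈ g x} := by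
      ext x
      simp [D, Finset.disjoint_insert_right, and_comm]
    have hsplit := measureReal_inter_add_sdiff (μ := μ) (s := D) hm
    rw [measureReal_restrict_apply hm, measureReal_restrict_apply MeasurableSet.univ,
      Set.univ_inter, Set.inter_comm] at hy
    have hfrac : (k : ℝ) / Fintype.card Y ≤ 1 :=
      div_le_one_of_le₀ (by exact_mod_cast hkY) (by positivity)
    rw [hdiff, pow_succ]
    calc
      μ.real (D \ {x | y ∈ g x}) ≤ μ.real D * (1 - (k : ℝ) / Fintype.card Y) := by linarith
      _ ≤ _ := mul_le_mul_of_nonneg_right hD (by linarith)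

end UniformFinsetMap

/-- Suppose `(X,μ)` is a standard probability space, `Y` is a finite set with
`|Y| = n`, `k ≤ n`, `m ∈ ℕ`, and `g : X → [Y]^k` is a measurable function assigning
to each `x ∈ X` a subset of `Y` of size exactly `k`. Then there is a set `S ⊆ Y` with
`|S| ≤ m` such that `μ {x : g(x) ∩ S ≠ ∅} ≥ 1 − (1 − k/n)^m`. -/
theorem prob_pigeonhole
    {X : Type*} [MeasurableSpace X] [StandardBorelSpace X]
    (μ : Measure X) [IsProbabilityMeasure μ]
    (Y : Type*) [Fintype Y] [DecidableEq Y]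
    (n k m : ℕ) (hcard : Fintype.card Y = n) (hkn : k ≤ n)
    (g : X → Finset Y)
    (hgmeas : ∀ A : Finset Y, MeasurableSet (g ⁻¹' {A}))
    (hgsize : ∀ x, (g x).card = k) :
    ∃ S : Finset Y, S.card ≤ m ∧
      ENNReal.ofReal (1 - (1 - (k : ℝ) / (n : ℝ)) ^ m) ≤
        μ {x | (g x ∩ S).Nonempty} := by
  subst hcard
  cases isEmpty_or_nonempty Y
  · exact ⟨∅, by simp⟩
  obtain ⟨S, hS, hD⟩ := exists_measureReal_disjoint_finset_map_le μ hgmeas hkn hgsize m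
  refine ⟨S, hS, ?_⟩
  have hcompl : {x | (g x ∩ S).Nonempty} = {x | Disjoint (g x) S}ᶜ := by
    ext x
    simp [Finset.not_disjoint_iff_nonempty_inter]
  have hm : MeasurableSet {x | Disjoint (g x) S} :=
    measurableSet_setOf_finset_map hgmeas (Disjoint · S)
  rw [hcompl, ← ofReal_measureReal, probReal_compl_eq_one_sub hm]
  exact ENNReal.ofReal_le_ofReal (by linarith)
end

section
/- Suppose E is a countable Borel equivalence relation on a standard Borel space X, (f_i)_{i∈ω} is a countable sequence of Borel functions from X to X^ω, and μ is a Borel probability measure on X. Then there is a μ-conull Borel set B ⊆ X such that the restriction E↾B is hyper-(f_i)-finite, i.e., there is an increasing sequence F_0 ⊆ F_1 ⊆ … of Borel subequivalence relations of E↾B with ⋃_n F_n = E↾B such that for no n, no x ∈ B, and no i is the set {f_i(x)(j) : j ∈ ω} infinite and contained in the F_n-class of x. -/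
open MeasureTheory

open Filter Topology Set
open scoped ENNReal

/-- A measurable injection of `X` into Cantor space, truncated to its first `m` coordinates. -/
noncomputable def cantorPrefix (X : Type*) [MeasurableSpace X] [StandardBorelSpace X]
    (m : ℕ) (y : X) : Fin m → Bool :=
  fun k => MeasurableSpace.mapNatBool X y k

theorem measurable_cantorPrefix {X : Type*} [MeasurableSpace X] [StandardBorelSpace X] (m : ℕ) :
    Measurable (cantorPrefix X m) :=
  measurable_pi_lambda _ fun k =>
    (measurable_pi_apply (k : ℕ)).comp (MeasurableSpace.measurable_mapNatBool X)

/-- On a finite set, sufficiently long prefixes separate points. -/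
theorem eventually_injOn_cantorPrefix {X : Type*} [MeasurableSpace X] [StandardBorelSpace X]
    (s : Finset X) : ∀ᶠ m in atTop, InjOn (cantorPrefix X m) s := by
  have key : ∀ a b : X, ∀ᶠ m in atTop, cantorPrefix X m a = cantorPrefix X m b → a = b := by
    intro a b
    by_cases hab : a = b
    · exact Eventually.of_forall fun _ _ => hab
    · obtain ⟨k, hk⟩ := Function.ne_iff.1
        ((MeasurableSpace.injective_mapNatBool X).ne hab)
      filter_upwards [eventually_gt_atTop k] with m hm h
      exact absurd (congrFun h ⟨k, hm⟩) hk
  have h : ∀ᶠ m in atTop, ∀ a ∈ s, ∀ b ∈ s,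
      cantorPrefix X m a = cantorPrefix X m b → a = b :=
    (Filter.eventually_all_finset s).2 fun a _ =>
      (Filter.eventually_all_finset s).2 fun b _ => key a b
  filter_upwards [h] with m hm a ha b hb hab using hm a ha b hb hab

theorem tendsto_ncard_image_cantorPrefix {X : Type*} [MeasurableSpace X] [StandardBorelSpace X]
    {Y : Set X} (hY : Y.Infinite) :
    Tendsto (fun m => (cantorPrefix X m '' Y).ncard) atTop atTop := by
  refine tendsto_atTop.2 fun M => ?_
  obtain ⟨s, hsY, hs⟩ := hY.exists_subset_card_eq M
  filter_upwards [eventually_injOn_cantorPrefix s] with m hm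
  calc M = (s : Set X).ncard := by rw [Set.ncard_coe_finset, hs]
    _ = (cantorPrefix X m '' s).ncard := hm.ncard_image.symm
    _ ≤ _ := Set.ncard_le_ncard (image_mono hsY) (Set.toFinite _)

/-- Under a product measure, the probability that all coordinates in `T` lie in `U`. -/
theorem pi_forall_mem_eq_pow {C L : Type*} [Fintype C] [MeasurableSpace L]
    (ν : Measure L) [IsProbabilityMeasure ν] (U : Set L) (T : Set C) :
    Measure.pi (fun _ : C => ν) {h | ∀ c ∈ T, h c ∈ U} = ν U ^ T.ncard := by
  classical
  have : {h : C → L | ∀ c ∈ T, h c ∈ U} = Set.pi univ fun c => if c ∈ T then U else univ := by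
    ext h
    simp only [mem_ofPred_eq, Set.mem_pi, mem_univ, true_implies]
    refine forall_congr' fun c => ?_
    split_ifs with hc <;> simp [hc]
  rw [this, Measure.pi_pi]
  simp only [apply_ite ν, measure_univ]
  rw [Finset.prod_ite, Finset.prod_const, Finset.prod_const_one, mul_one,
    Set.ncard_eq_toFinset_card', Set.toFinset, Set.filter_mem_univ_eq_toFinset]
  rfl

theorem measurableSet_infinite_range {X Y : Type*} [MeasurableSpace X] [StandardBorelSpace X]
    [MeasurableSpace Y] {f : Y → ℕ → X} (hf : Measurable f) :
    MeasurableSet {x | (range (f x)).Infinite} := by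
  have hfj : ∀ j, Measurable fun x => f x j := fun j => (measurable_pi_apply j).comp hf
  have : {x | (range (f x)).Infinite} =
      (⋃ N : ℕ, ⋂ j : ℕ, ⋃ i : ℕ, ⋃ _ : i ≤ N, {x | f x i = f x j})ᶜ := by
    ext x
    simp only [mem_ofPred_eq, mem_compl_iff, mem_iUnion, mem_iInter, Set.Infinite, not_iff_not]
    constructor
    · intro h
      choose g hg using fun y : range (f x) => y.2
      have := h.to_subtype
      obtain ⟨N, hN⟩ := (Set.finite_range g).bddAbove
      exact ⟨N, fun j => ⟨g ⟨f x j, mem_range_self j⟩, hN (mem_range_self _), hg _⟩⟩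
    · rintro ⟨N, hN⟩
      refine ((Set.finite_Iic N).image (f x)).subset ?_
      rintro _ ⟨j, rfl⟩
      obtain ⟨i, hi, hij⟩ := hN j
      exact ⟨i, hi, hij⟩
  rw [this]
  exact (MeasurableSet.iUnion fun N => MeasurableSet.iInter fun j => MeasurableSet.iUnion fun i =>
    MeasurableSet.iUnion fun _ => measurableSet_eq_fun (hfj i) (hfj j)).compl

/-- There are Borel sets of small measure meeting most of the infinite sets in a
measurable family: a random union of long cylinders works on average. -/
theorem exists_small_measurableSet_hitting {X : Type*} [MeasurableSpace X] [StandardBorelSpace X]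
    (μ : Measure X) [IsProbabilityMeasure μ] {f : X → ℕ → X} (hf : Measurable f)
    {ε : ℝ≥0∞} (hε : ε ≠ 0) :
    ∃ A, MeasurableSet A ∧ μ A ≤ ε ∧
      μ {x | (range (f x)).Infinite ∧ ∀ j, f x j ∉ A} ≤ ε := by
  have hfj : ∀ j, Measurable fun x => f x j := fun j => (measurable_pi_apply j).comp hf
  set S := {x | (range (f x)).Infinite} with hS
  have hSm : MeasurableSet S := measurableSet_infinite_range hf
  obtain ⟨p, hp0, hp⟩ : ∃ p : ℝ≥0∞, 0 < p ∧ p < min (ε / 2) 1 :=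
    exists_between (lt_min (ENNReal.half_pos hε) one_pos)
  have hp1 : p ≤ 1 := (hp.trans_le (min_le_right _ _)).le
  have hpε : p ≤ ε / 2 := (hp.trans_le (min_le_left _ _)).le
  set ν : Measure Bool := (1 - p) • Measure.dirac false + p • Measure.dirac true with hν
  have : IsProbabilityMeasure ν := ⟨by simp [hν, tsub_add_cancel_of_le hp1]⟩
  have hνt : ν {true} = p := by simp [hν]
  have hνf : ν {false} = 1 - p := by simp [hν]
  have hq : 1 - p < 1 := ENNReal.sub_lt_self ENNReal.one_ne_top one_ne_zero hp0.ne'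
  let P (m : ℕ) : Measure ((Fin m → Bool) → Bool) := Measure.pi fun _ => ν
  let bad (m : ℕ) (h : (Fin m → Bool) → Bool) : Set X :=
    {x | ∀ j, h (cantorPrefix X m (f x j)) = false}
  have hbadm : ∀ m h, MeasurableSet (bad m h) := fun m h => by
    simp only [bad, ofPred_forall]
    exact MeasurableSet.iInter fun j =>
      (Measurable.of_discrete.comp ((measurable_cantorPrefix m).comp (hfj j)))
        (measurableSet_singleton false)
  have hP : ∀ m x, P m {h | x ∈ bad m h} =
      (1 - p) ^ (cantorPrefix X m '' range (f x)).ncard := fun m x => by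
    rw [← hνf, ← pi_forall_mem_eq_pow]
    congr 1
    ext h
    simp [bad]
  have hjoint : ∀ m (D : ((Fin m → Bool) → Bool) → Set X), (∀ h, MeasurableSet (D h)) →
      MeasurableSet {q : ((Fin m → Bool) → Bool) × X | q.2 ∈ D q.1} := fun m D hD => by
    have : {q : ((Fin m → Bool) → Bool) × X | q.2 ∈ D q.1} = ⋃ h, {h} ×ˢ D h := by
      ext ⟨h, x⟩
      simp
    rw [this]
    exact MeasurableSet.iUnion fun h => (measurableSet_singleton h).prod (hD h)
  have hfub : ∀ m (ρ : Measure X) [IsFiniteMeasure ρ]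
      (D : ((Fin m → Bool) → Bool) → Set X), (∀ h, MeasurableSet (D h)) →
      ∫⁻ h, ρ (D h) ∂P m = ∫⁻ x, P m {h | x ∈ D h} ∂ρ := fun m ρ _ D hD => by
    have h1 := Measure.prod_apply (μ := P m) (ν := ρ) (hjoint m D hD)
    have h2 := Measure.prod_apply_symm (μ := P m) (ν := ρ) (hjoint m D hD)
    exact h1.symm.trans h2
  have hlim : Tendsto (fun m => ∫⁻ x in S, P m {h | x ∈ bad m h} ∂μ) atTop (𝓝 0) := by
    have := tendsto_lintegral_of_dominated_convergence (μ := μ.restrict S)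
      (F := fun m x => P m {h | x ∈ bad m h}) (f := fun _ => 0) (fun _ => 1)
      (fun m => measurable_measure_prodMk_right (hjoint m _ (hbadm m)))
      (fun m => Eventually.of_forall fun x => prob_le_one) (by simp)
      ((ae_restrict_iff' hSm).2 (Eventually.of_forall fun x hx => by
        simp only [hP]
        exact (ENNReal.tendsto_pow_atTop_nhds_zero_of_lt_one hq).comp
          (tendsto_ncard_image_cantorPrefix hx)))
    simpa using this
  obtain ⟨m, hm⟩ := ((ENNReal.tendsto_nhds_zero.1 hlim) _ (ENNReal.half_pos hε)).exists
  let A (h : (Fin m → Bool) → Bool) : Set X := {x | h (cantorPrefix X m x) = true}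
  have hAm : ∀ h, MeasurableSet (A h) := fun h =>
    (Measurable.of_discrete.comp (measurable_cantorPrefix m)) (measurableSet_singleton true)
  have hPA : ∀ x, P m {h | x ∈ A h} = p := fun x => by
    have := pi_forall_mem_eq_pow ν {true} {cantorPrefix X m x}
    simpa [hνt, P, A] using this
  have hint : ∫⁻ h, (μ (A h) + μ.restrict S (bad m h)) ∂P m ≤ ε := by
    rw [lintegral_add_left Measurable.of_discrete, hfub m μ A hAm,
      hfub m (μ.restrict S) (bad m) (hbadm m)]
    simp only [hPA, lintegral_const, measure_univ, mul_one]
    exact (add_le_add hpε hm).trans (ENNReal.add_halves ε).le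
  obtain ⟨h, hh⟩ := exists_le_lintegral (μ := P m)
    (f := fun h => μ (A h) + μ.restrict S (bad m h)) Measurable.of_discrete.aemeasurable
  have hle := hh.trans hint
  refine ⟨A h, hAm h, le_self_add.trans hle, ?_⟩
  refine le_trans (le_of_eq ?_) (le_add_self.trans hle)
  rw [Measure.restrict_apply (hbadm m h)]
  congr 1
  ext x
  simp [hS, bad, A, and_comm]

/-- Suppose `E` is a countable Borel equivalence relation on a standard Borel space
`X`, `(f_i)` is a countable sequence of Borel functions `X → X^ω`, and `μ` is a Borel
probability measure on `X`. Then there is a `μ`-conull Borel set `B ⊆ X` such that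
`E↾B` is hyper-`(f_i)`-finite: there is an increasing sequence `F_0 ⊆ F_1 ⊆ …` of
Borel subequivalence relations of `E↾B` with `⋃_n F_n = E↾B` such that for no `n`,
no `x ∈ B`, and no `i` is the set `{f_i(x)(j) : j ∈ ω}` infinite and contained in the
`F_n`-class of `x`. -/
theorem measure_hyperFin
    {X : Type*} [MeasurableSpace X] [StandardBorelSpace X]
    (E : X → X → Prop) (hE : Equivalence E)
    (hEBorel : MeasurableSet {p : X × X | E p.1 p.2})
    (hEcount : ∀ x, {y | E x y}.Countable)
    (f : ℕ → X → ℕ → X) (hf : ∀ i, Measurable (f i))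
    (μ : Measure X) [IsProbabilityMeasure μ] :
    ∃ B : Set X, MeasurableSet B ∧ μ Bᶜ = 0 ∧
      ∃ F : ℕ → X → X → Prop,
        (∀ n a b, F n a b → a ∈ B ∧ b ∈ B ∧ E a b) ∧
        (∀ n, ∀ a ∈ B, F n a a) ∧
        (∀ n a b, F n a b → F n b a) ∧
        (∀ n a b c, F n a b → F n b c → F n a c) ∧
        (∀ n, MeasurableSet {p : X × X | F n p.1 p.2}) ∧
        (∀ n a b, F n a b → F (n + 1) a b) ∧
        (∀ a b, (a ∈ B ∧ b ∈ B ∧ E a b) ↔ ∃ n, F n a b) ∧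
        (∀ n, ∀ x ∈ B, ∀ i, (Set.range (f i x)).Infinite →
          ¬ Set.range (f i x) ⊆ {y | F n x y}) := by
  have hε : ∀ k : ℕ, (2⁻¹ : ℝ≥0∞) ^ k ≠ 0 := fun k => pow_ne_zero _ (by simp)
  choose A hAm hAμ hAbad using fun k : ℕ =>
    exists_small_measurableSet_hitting μ (hf k.unpair.1) (hε k)
  set bad : ℕ → Set X :=
    fun k => {x | (range (f k.unpair.1 x)).Infinite ∧ ∀ j, f k.unpair.1 x j ∉ A k} with hbad
  have hsum : ∑' k : ℕ, (2⁻¹ : ℝ≥0∞) ^ k ≠ ∞ := by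
    rw [ENNReal.tsum_geometric]
    simp
  have hA0 : ∀ᵐ x ∂μ, ∀ᶠ k in atTop, x ∉ A k :=
    ae_eventually_notMem (ne_top_of_le_ne_top hsum (ENNReal.tsum_le_tsum hAμ))
  have hbad0 : ∀ᵐ x ∂μ, ∀ᶠ k in atTop, x ∉ bad k :=
    ae_eventually_notMem (ne_top_of_le_ne_top hsum (ENNReal.tsum_le_tsum hAbad))
  obtain ⟨B, hBsub, hBm, hBμ⟩ : ∃ B ⊆ {x | (∀ᶠ k in atTop, x ∉ A k) ∧ ∀ᶠ k in atTop, x ∉ bad k},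
      MeasurableSet B ∧ μ Bᶜ = 0 := by
    refine ⟨(toMeasurable μ _)ᶜ, compl_subset_comm.1 (subset_toMeasurable μ _),
      (measurableSet_toMeasurable _ _).compl, ?_⟩
    rw [compl_compl, measure_toMeasurable]
    exact hA0.and hbad0
  let V (n : ℕ) : Set X := ⋃ k ≥ n, A k
  have hVm : ∀ n, MeasurableSet (V n) := fun n =>
    MeasurableSet.iUnion fun k => MeasurableSet.iUnion fun _ => hAm k
  have hVanti : ∀ n, V (n + 1) ⊆ V n := fun n =>
    biUnion_mono (fun k (hk : n + 1 ≤ k) => (Nat.le_succ n).trans hk) fun _ _ => Subset.rfl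
  have hVout : ∀ x ∈ B, ∀ᶠ n in atTop, x ∉ V n := fun x hx => by
    filter_upwards [eventually_forall_ge_atTop.2 (hBsub hx).1] with n hn
    simpa [V] using hn
  refine ⟨B, hBm, hBμ,
    fun n a b => (a ∈ B ∧ b ∈ B ∧ E a b) ∧ (a = b ∨ (a ∉ V n ∧ b ∉ V n)),
    fun n a b h => h.1, fun n a ha => ⟨⟨ha, ha, hE.refl a⟩, Or.inl rfl⟩, ?_, ?_, ?_, ?_, ?_, ?_⟩
  · rintro n a b ⟨⟨ha, hb, hab⟩, h⟩
    exact ⟨⟨hb, ha, hE.symm hab⟩, h.imp Eq.symm And.symm⟩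
  · rintro n a b c ⟨⟨ha, hb, hab⟩, h⟩ ⟨⟨-, hc, hbc⟩, h'⟩
    refine ⟨⟨ha, hc, hE.trans hab hbc⟩, ?_⟩
    rcases h with rfl | h
    · exact h'
    · rcases h' with rfl | h'
      · exact Or.inr h
      · exact Or.inr ⟨h.1, h'.2⟩
  · intro n
    exact ((measurable_fst hBm).inter ((measurable_snd hBm).inter hEBorel)).inter
      ((measurableSet_eq_fun measurable_fst measurable_snd).union
        ((measurable_fst (hVm n).compl).inter (measurable_snd (hVm n).compl)))
  · rintro n a b ⟨h, h'⟩
    exact ⟨h, h'.imp_right fun h' => ⟨fun ha => h'.1 (hVanti n ha), fun hb => h'.2 (hVanti n hb)⟩⟩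
  · refine fun a b => ⟨fun h => ?_, fun ⟨n, h⟩ => h.1⟩
    obtain ⟨n, hn⟩ := ((hVout a h.1).and (hVout b h.2.1)).exists
    exact ⟨n, h, Or.inr hn⟩
  · intro n x hx i hinf hsub
    have hxV : x ∉ V n := fun hxV => by
      refine hinf ((finite_singleton x).subset fun y hy => ?_)
      rcases (hsub hy).2 with h | h
      · exact h.symm
      · exact absurd hxV h.1
    have hV : ∀ j, f i x j ∉ V n := fun j => by
      rcases (hsub (mem_range_self j)).2 with h | h
      · exact h ▸ hxV
      · exact h.2
    obtain ⟨N, hN⟩ := eventually_atTop.1 (hBsub hx).2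
    have hk := hN (Nat.pair i (max n N)) ((le_max_right n N).trans (Nat.right_le_pair _ _))
    refine hk ?_
    simp only [hbad, mem_ofPred_eq, Nat.unpair_pair]
    refine ⟨hinf, fun j hj => hV j ?_⟩
    exact mem_biUnion (show n ≤ _ from (le_max_left n N).trans (Nat.right_le_pair i _)) hj
end

section
/- Suppose E is a countable Borel equivalence relation on a standard Borel space X, μ is a Borel probability measure on X, f : X → X^ω is a Borel function, and ε > 0. Then there is a Borel set A ⊆ X with μ(A) > 1 − ε such that for every x ∈ A, if the set {f(x)(j) : j ∈ ω} is infinite, then it is not contained in the (E↾A)-class of x (that is, no (E↾A)-class contains an infinite set of the form {f(x)(j) : j ∈ ω} for x ∈ A). -/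
open MeasureTheory

/-- The proportion of functions `ι → κ` that map a fixed finite set `S` into `T` is
`(|T| / |κ|) ^ |S|`. -/
theorem card_filter_forall_mem {ι κ : Type*} [Fintype ι] [DecidableEq ι] [Fintype κ]
    [DecidableEq κ] (S : Finset ι) (T : Finset κ) :
    (Finset.univ.filter fun c : ι → κ => ∀ s ∈ S, c s ∈ T).card * Fintype.card κ ^ S.card =
      T.card ^ S.card * Fintype.card (ι → κ) := by
  have h : (Finset.univ.filter fun c : ι → κ => ∀ s ∈ S, c s ∈ T) =
      Fintype.piFinset fun s => if s ∈ S then T else Finset.univ := by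
    ext c
    simp only [Finset.mem_filter, Finset.mem_univ, true_and, Fintype.mem_piFinset]
    refine forall_congr' fun s => ?_
    by_cases hs : s ∈ S <;> simp [hs]
  have hcard : Sᶜ.card + S.card = Fintype.card ι := by
    rw [add_comm, Finset.card_add_card_compl]
  rw [h, Fintype.card_piFinset, Fintype.card_fun, ← hcard, pow_add]
  simp only [apply_ite Finset.card, Finset.prod_ite, Finset.prod_const, Finset.card_univ,
    Finset.filter_mem_eq_inter, Finset.univ_inter]
  rw [Finset.filter_not, Finset.filter_mem_eq_inter, Finset.univ_inter,
    ← Finset.compl_eq_univ_sdiff]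
  ring

/-- If every point lies in at most a proportion `δ` of finitely many measurable sets, then one
of these sets has measure at most `δ`. -/
theorem exists_measureReal_le_of_card_filter_le {X Ω : Type*} [MeasurableSpace X]
    (μ : Measure X) [IsProbabilityMeasure μ] [Fintype Ω] [Nonempty Ω] (D : Ω → Set X)
    (hD : ∀ c, MeasurableSet (D c)) (δ : ℝ)
    (h : ∀ x, ∃ F : Finset Ω, (∀ c, x ∈ D c → c ∈ F) ∧ (F.card : ℝ) ≤ δ * Fintype.card Ω) :
    ∃ c, μ.real (D c) ≤ δ := by
  classical
  have hint : ∀ c, Integrable ((D c).indicator (1 : X → ℝ)) μ := fun c =>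
    (integrable_const (1 : ℝ)).indicator (hD c)
  have hsum : ∑ c, μ.real (D c) ≤ ∑ _c : Ω, δ := by
    calc ∑ c, μ.real (D c) = ∫ x, ∑ c, (D c).indicator (1 : X → ℝ) x ∂μ := by
          rw [integral_finsetSum _ fun c _ => hint c]
          simp only [integral_indicator_one (hD _)]
      _ ≤ ∫ _, δ * Fintype.card Ω ∂μ := by
          refine integral_mono (integrable_finsetSum _ fun c _ => hint c)
            (integrable_const _) fun x => ?_
          obtain ⟨F, hF, hcard⟩ := h x
          refine le_trans ?_ hcard
          simp only [Set.indicator_apply, Pi.one_apply, Finset.sum_boole]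
          exact_mod_cast Finset.card_le_card fun c hc => hF c (by simpa using hc)
      _ = ∑ _c : Ω, δ := by simp [mul_comm]
  obtain ⟨c, -, hc⟩ := Finset.exists_le_of_sum_le Finset.univ_nonempty hsum
  exact ⟨c, hc⟩

/-- The first `n` binary digits of a point, for a fixed Borel injection into Cantor space. -/
noncomputable def binaryPrefix (X : Type*) [MeasurableSpace X]
    [MeasurableSpace.CountablyGenerated X] (n : ℕ) (x : X) : Fin n → Bool :=
  fun i => MeasurableSpace.mapNatBool X x i

theorem measurable_binaryPrefix (X : Type*) [MeasurableSpace X]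
    [MeasurableSpace.CountablyGenerated X] (n : ℕ) : Measurable (binaryPrefix X n) :=
  measurable_pi_lambda _ fun i =>
    (measurable_pi_apply (i : ℕ)).comp (MeasurableSpace.measurable_mapNatBool X)

theorem binaryPrefix_ne_of_le {X : Type*} [MeasurableSpace X]
    [MeasurableSpace.CountablyGenerated X] {m n : ℕ} (hmn : m ≤ n) {x y : X}
    (h : binaryPrefix X m x ≠ binaryPrefix X m y) : binaryPrefix X n x ≠ binaryPrefix X n y :=
  fun h' => h <| funext fun i => congrFun h' (Fin.castLE hmn i)

theorem exists_binaryPrefix_ne {X : Type*} [MeasurableSpace X]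
    [MeasurableSpace.CountablyGenerated X] [MeasurableSpace.SeparatesPoints X] {x y : X}
    (h : x ≠ y) : ∃ n, binaryPrefix X n x ≠ binaryPrefix X n y := by
  obtain ⟨i, hi⟩ := Function.ne_iff.1 ((MeasurableSpace.injective_mapNatBool X).ne h)
  exact ⟨i + 1, fun h' => hi (congrFun h' (Fin.last i))⟩

/-- The points `x` such that `f x` takes at least `N` values that are pairwise distinguished by
their first `n` binary digits. -/
def separatedSet {X : Type*} [MeasurableSpace X] [MeasurableSpace.CountablyGenerated X]
    (f : X → ℕ → X) (N n : ℕ) : Set X :=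
  {x | ∃ J : Fin N → ℕ, Function.Injective fun i => binaryPrefix X n (f x (J i))}

theorem measurableSet_separatedSet {X : Type*} [MeasurableSpace X]
    [MeasurableSpace.CountablyGenerated X] {f : X → ℕ → X} (hf : Measurable f) (N n : ℕ) :
    MeasurableSet (separatedSet f N n) := by
  have hm : ∀ j, Measurable fun x => binaryPrefix X n (f x j) := fun j =>
    (measurable_binaryPrefix X n).comp ((measurable_pi_apply j).comp hf)
  simp only [separatedSet, Function.Injective, Set.ofPred_exists, Set.ofPred_forall]
  refine .iUnion fun J => .iInter fun a => .iInter fun b => ?_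
  by_cases hab : a = b
  · simp [hab]
  · simp only [hab, imp_false]
    exact (measurableSet_eq_fun (hm (J a)) (hm (J b))).compl

theorem monotone_separatedSet {X : Type*} [MeasurableSpace X]
    [MeasurableSpace.CountablyGenerated X] (f : X → ℕ → X) (N : ℕ) :
    Monotone (separatedSet f N) := by
  rintro m n hmn x ⟨J, hJ⟩
  refine ⟨J, fun a b hab => ?_⟩
  by_contra hne
  exact binaryPrefix_ne_of_le hmn (hJ.ne hne) hab

theorem mem_iUnion_separatedSet {X : Type*} [MeasurableSpace X]
    [MeasurableSpace.CountablyGenerated X] [MeasurableSpace.SeparatesPoints X]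
    {f : X → ℕ → X} (N : ℕ) {x : X} (hx : (Set.range (f x)).Infinite) :
    x ∈ ⋃ n, separatedSet f N n := by
  have hy := fun i : ℕ => (hx.natEmbedding _ i).2
  choose J hJ using hy
  have hne : ∀ p : Fin N × Fin N, p.1 ≠ p.2 →
      ∃ n, binaryPrefix X n (f x (J p.1)) ≠ binaryPrefix X n (f x (J p.2)) := by
    intro p hp
    apply exists_binaryPrefix_ne
    rw [hJ, hJ]
    exact fun h => hp (Fin.ext ((hx.natEmbedding _).injective (Subtype.ext h)))
  choose! g hg using hne
  refine Set.mem_iUnion.2 ⟨Finset.univ.sup g, fun i => J i, fun a b hab => ?_⟩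
  by_contra h
  exact binaryPrefix_ne_of_le (Finset.le_sup (f := g) (Finset.mem_univ (a, b))) (hg (a, b) h) hab

/-- A set of small measure meeting `f x` for most `x` among those for which `f x` takes many
distinguishable values: it is a union of cylinders chosen by a random colouring. -/
theorem exists_coloring_measureReal_le {X : Type*} [MeasurableSpace X]
    [MeasurableSpace.CountablyGenerated X] (μ : Measure X) [IsProbabilityMeasure μ]
    {f : X → ℕ → X} (hf : Measurable f) (K N n : ℕ) :
    ∃ B : Set X, MeasurableSet B ∧ MeasurableSet {x | ∀ j, f x j ∉ B} ∧
      μ.real (B ∪ (separatedSet f N n ∩ {x | ∀ j, f x j ∉ B})) ≤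
        1 / (K + 1 : ℝ) + (K / (K + 1 : ℝ)) ^ N := by
  classical
  let B : ((Fin n → Bool) → Fin (K + 1)) → Set X := fun c => {x | c (binaryPrefix X n x) = 0}
  have hB : ∀ c, MeasurableSet (B c) := fun c =>
    ((measurable_of_finite c).comp (measurable_binaryPrefix X n)) (measurableSet_singleton 0)
  have hM : ∀ c, MeasurableSet {x | ∀ j, f x j ∉ B c} := fun c => by
    rw [Set.ofPred_forall]
    exact .iInter fun j => ((measurable_pi_apply j).comp hf) (hB c).compl
  suffices h : ∃ c, μ.real (B c ∪ (separatedSet f N n ∩ {x | ∀ j, f x j ∉ B c})) ≤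
      1 / (K + 1 : ℝ) + (K / (K + 1 : ℝ)) ^ N by
    obtain ⟨c, hc⟩ := h
    exact ⟨B c, hB c, hM c, hc⟩
  refine exists_measureReal_le_of_card_filter_le μ _
    (fun c => (hB c).union ((measurableSet_separatedSet hf N n).inter (hM c))) _ ?_
  let F (S : Finset (Fin n → Bool)) (T : Finset (Fin (K + 1))) :=
    Finset.univ.filter fun c : (Fin n → Bool) → Fin (K + 1) => ∀ s ∈ S, c s ∈ T
  have hcount (S : Finset (Fin n → Bool)) (T : Finset (Fin (K + 1))) :
      ((F S T).card : ℝ) = (T.card / (K + 1 : ℝ)) ^ S.card *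
        Fintype.card ((Fin n → Bool) → Fin (K + 1)) := by
    have h := card_filter_forall_mem S T
    rw [Fintype.card_fin] at h
    rw [div_pow, div_mul_eq_mul_div, eq_div_iff (by positivity)]
    exact_mod_cast h
  intro x
  have h₁ := hcount {binaryPrefix X n x} {0}
  have hx₁ : ∀ c, x ∈ B c → c ∈ F {binaryPrefix X n x} {0} := fun c hc => by
    simpa [F] using show c (binaryPrefix X n x) = 0 from hc
  simp only [Finset.card_singleton, Nat.cast_one, pow_one] at h₁
  by_cases hx : x ∈ separatedSet f N n
  · obtain ⟨J, hJ⟩ := id hx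
    have h₂ := hcount (Finset.univ.image fun i => binaryPrefix X n (f x (J i))) {0}ᶜ
    rw [Finset.card_image_of_injective _ hJ, Finset.card_univ, Fintype.card_fin,
      Finset.card_compl, Fintype.card_fin, Finset.card_singleton, Nat.add_sub_cancel] at h₂
    refine ⟨F {binaryPrefix X n x} {0} ∪
      F (Finset.univ.image fun i => binaryPrefix X n (f x (J i))) {0}ᶜ, fun c hc => ?_, ?_⟩
    · rcases hc with hc | ⟨-, hc⟩
      · exact Finset.mem_union_left _ (hx₁ c hc)
      · refine Finset.mem_union_right _ ?_
        simp only [F, Finset.mem_filter, Finset.mem_univ, true_and, Finset.mem_image]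
        rintro _ ⟨i, rfl⟩
        simpa using show c (binaryPrefix X n (f x (J i))) ≠ 0 from hc (J i)
    · refine (Nat.cast_le.2 (Finset.card_union_le _ _)).trans ?_
      rw [Nat.cast_add, add_mul]
      exact add_le_add h₁.le h₂.le
  · refine ⟨F {binaryPrefix X n x} {0}, fun c hc => ?_, h₁.le.trans ?_⟩
    · exact hc.elim (hx₁ c) fun h => absurd h.1 hx
    · gcongr
      exact le_add_of_nonneg_right (by positivity)

/-- Suppose `E` is a countable Borel equivalence relation on a standard Borel space
`X`, `μ` is a Borel probability measure on `X`, `f : X → X^ω` is a Borel function,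
and `ε > 0`. Then there is a Borel set `A ⊆ X` with `μ(A) > 1 − ε` such that for
every `x ∈ A`, if the set `{f(x)(j) : j ∈ ω}` is infinite, then it is not contained
in the `(E↾A)`-class of `x`. -/
theorem measure_fFin
    {X : Type*} [MeasurableSpace X] [StandardBorelSpace X]
    (E : X → X → Prop) (hE : Equivalence E)
    (hEBorel : MeasurableSet {p : X × X | E p.1 p.2})
    (hEcount : ∀ x, {y | E x y}.Countable)
    (μ : Measure X) [IsProbabilityMeasure μ]
    (f : X → ℕ → X) (hf : Measurable f)
    (ε : ℝ) (hε : 0 < ε) :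
    ∃ A : Set X, MeasurableSet A ∧ ENNReal.ofReal (1 - ε) < μ A ∧
      ∀ x ∈ A, (Set.range (f x)).Infinite →
        ¬ Set.range (f x) ⊆ {y | y ∈ A ∧ E x y} := by
  set η := min ε (1 / 2)
  have hη0 : 0 < η := by positivity
  obtain ⟨K, hK⟩ := exists_nat_one_div_lt (show 0 < η / 3 by positivity)
  obtain ⟨N, hN⟩ := exists_pow_lt_of_lt_one (show 0 < η / 3 by positivity)
    (show (K / (K + 1 : ℝ)) < 1 by rw [div_lt_one (by positivity)]; linarith)
  set G := separatedSet f N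
  have hG : ∀ n, MeasurableSet (G n) := measurableSet_separatedSet hf N
  obtain ⟨n, hn⟩ : ∃ n, μ.real (⋃ m, G m) - η / 3 < μ.real (G n) :=
    (((ENNReal.tendsto_toReal (measure_ne_top μ _)).comp
      (tendsto_measure_iUnion_atTop (monotone_separatedSet f N))).eventually
      (lt_mem_nhds (sub_lt_self _ (by positivity)))).exists
  have hdiff := measureReal_sdiff (μ := μ) (Set.subset_iUnion G n) (hG n)
  obtain ⟨B, hB, hM, hBμ⟩ := exists_coloring_measureReal_le μ hf K N n
  set C := (B ∪ (G n ∩ {x | ∀ j, f x j ∉ B})) ∪ ((⋃ m, G m) \ G n)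
  have hC : MeasurableSet C :=
    (hB.union ((hG n).inter hM)).union ((MeasurableSet.iUnion hG).diff (hG n))
  have hCμ : μ.real C < η := by
    have := measureReal_union_le (μ := μ) (B ∪ (G n ∩ {x | ∀ j, f x j ∉ B})) ((⋃ m, G m) \ G n)
    linarith
  refine ⟨Cᶜ, hC.compl, ?_, fun x hx hinf hsub => ?_⟩
  · have h1 := probReal_compl_eq_one_sub (μ := μ) hC
    have h2 : η ≤ 1 / 2 := min_le_right _ _
    have h3 : η ≤ ε := min_le_left _ _
    rw [← ofReal_measureReal, ENNReal.ofReal_lt_ofReal_iff (by linarith)]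
    linarith
  · have hxG : x ∈ G n := by
      by_contra h
      exact hx (Or.inr ⟨mem_iUnion_separatedSet N hinf, h⟩)
    refine hx (Or.inl (Or.inr ⟨hxG, fun j hj => ?_⟩))
    exact (hsub ⟨j, rfl⟩).1 (Or.inl (Or.inl hj))
end

section
/- If f : 2^ω → 2^ω is a Borel function such that f(x) is x-generic for every x ∈ 2^ω, then the range of f is nonmeager in 2^ω. -/
open scoped Classical

namespace SlamanSteel

/-- Constant functions are recursive in any oracle. -/
lemma RecursiveIn.const (O : ℕ → ℕ) (n : ℕ) : RecursiveIn O fun _ => Part.some n := by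
  induction n with
  | zero => exact RecursiveIn.zero
  | succ n ih => simpa using RecursiveIn.succ.comp ih

/-- The set of strings whose code is a zero of the `n`th section of the oracle is c.e. in it. -/
lemma ceIn_setOf_section_eq_false (x : ℕ → Bool) (n : ℕ) :
    CEIn x {σ | x (Nat.pair n (Encodable.encode σ)) = false} := by
  have h := (RecursiveIn.oracle (O := oracleOf x)).comp
    ((RecursiveIn.const _ n).pair RecursiveIn.left)
  refine ⟨_, h.rfind, fun σ => ?_⟩
  refine Iff.trans ?_ Nat.rfind_dom.symm
  cases hx : x (Nat.pair n (Encodable.encode σ)) <;> simp [Seq.seq, oracleOf, hx]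

lemma initSeg_eq_initSeg_iff (x y : ℕ → Bool) (k : ℕ) :
    initSeg x k = initSeg y k ↔ x ∈ PiNat.cylinder y k := by
  simp [initSeg, PiNat.cylinder]

lemma length_initSeg (x : ℕ → Bool) (k : ℕ) : (initSeg x k).length = k := by
  simp [initSeg]

lemma initSeg_prefix (x : ℕ → Bool) {k m : ℕ} (h : k ≤ m) : initSeg x k <+: initSeg x m := by
  obtain ⟨d, rfl⟩ := Nat.exists_eq_add_of_le h
  simp [initSeg, List.range_add]

/-- The strings all of whose infinite extensions lie in `U`. -/
def stringsInside (U : Set (ℕ → Bool)) : Set (List Bool) :=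
  {σ | ∀ g, initSeg g σ.length = σ → g ∈ U}

/-- Every initial segment extends to a string determining membership in a dense open set. -/
lemma exists_prefix_mem_stringsInside {U : Set (ℕ → Bool)} (hU : IsOpen U) (hd : Dense U)
    (g : ℕ → Bool) (k : ℕ) : ∃ τ, initSeg g k <+: τ ∧ τ ∈ stringsInside U := by
  obtain ⟨h, hk, hhU⟩ := hd.inter_open_nonempty _ (PiNat.isOpen_cylinder (fun _ => Bool) g k)
    ⟨g, PiNat.self_mem_cylinder g k⟩
  obtain ⟨_, ⟨y, m, rfl⟩, hm, hsub⟩ :=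
    (PiNat.isTopologicalBasis_cylinders (fun _ => Bool)).exists_subset_of_mem_open hhU hU
  refine ⟨initSeg h (max k m), ?_, fun z hz => hsub ?_⟩
  · rw [← (initSeg_eq_initSeg_iff h g k).2 hk]
    exact initSeg_prefix h (le_max_left k m)
  · rw [length_initSeg, initSeg_eq_initSeg_iff] at hz
    rw [← PiNat.mem_cylinder_iff_eq.1 hm]
    exact PiNat.cylinder_anti h (le_max_right k m) hz

/-- A real generic relative to an oracle enumerating a dense open set lies in that set. -/
lemma GenericIn.mem_of_dense {x g : ℕ → Bool} (hg : GenericIn x g) {U : Set (ℕ → Bool)}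
    (hU : IsOpen U) (hd : Dense U) (hce : CEIn x (stringsInside U)) : g ∈ U := by
  obtain ⟨k, hk | hk⟩ := hg _ hce
  · exact hk g (by rw [length_initSeg])
  · obtain ⟨τ, hτ, hmem⟩ := exists_prefix_mem_stringsInside hU hd g k
    exact absurd hmem (hk τ hτ)

/-- Countably many sets of strings are simultaneously c.e. in a single real. -/
lemma exists_forall_ceIn {ι : Type*} [Countable ι] (W : ι → Set (List Bool)) :
    ∃ x, ∀ i, CEIn x (W i) := by
  obtain ⟨e, he⟩ := exists_injective_nat ι
  let x : ℕ → Bool := fun k =>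
    !decide (∃ i, ∃ σ ∈ W i, e i = k.unpair.1 ∧ Encodable.encode σ = k.unpair.2)
  refine ⟨x, fun i => ?_⟩
  convert ceIn_setOf_section_eq_false x (e i) using 1
  ext σ
  simp [x, he.eq_iff]

/-- If `f : 2^ω → 2^ω` is a Borel function such that `f(x)` is `x`-generic for every
`x ∈ 2^ω`, then the range of `f` is nonmeager in `2^ω`. -/
theorem range_nonmeager_of_relatively_generic
    (f : (ℕ → Bool) → ℕ → Bool) (hf : Measurable f)
    (hgen : ∀ x, GenericIn x (f x)) :
    ¬ IsMeagre (Set.range f) := by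
  intro hm
  obtain ⟨S, hSo, hSd, hSc, hsub⟩ := mem_residual_iff.1 hm
  have := hSc.to_subtype
  obtain ⟨x, hx⟩ := exists_forall_ceIn fun U : S => stringsInside U.1
  exact hsub (fun U hU => (hgen x).mem_of_dense (hSo U hU) (hSd U hU) (hx ⟨U, hU⟩))
    (Set.mem_range_self x)

end SlamanSteel
end
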